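/- arXiv:2103.10523 — 2 statements merged into one kernel-verified Lean document; each statement's English description precedes it below -/
import Mathlib

section
/- Let M and N be positive integers and suppose the rectangle R = [0,M] × [0,N] ⊆ ℝ² is dissected into n axis-parallel rectangular tiles with positive integer side lengths a_i × b_i (i = 1,…,n). Let d = gcd(gcd(a_1,b_1), …, gcd(a_n,b_n)) and for each i let δ_i = max(a_i,b_i) / gcd(a_i,b_i) (the arithmetic bias of the i-th tile). Then τ^(δ_1 + δ_2 + ⋯ + δ_n) ≥ max(M,N)/d; equivalently, δ_1 + ⋯ + δ_n ≥ log_τ(max(M,N)/d). -/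
open scoped BigOperators

/-- The closed axis-parallel rectangle `[x, x+a] × [y, y+b] ⊆ ℝ²` with lower-left
corner `(x, y)`, width `a` and height `b`. -/
def rectTile (x y : ℝ) (a b : ℕ) : Set (ℝ × ℝ) :=
  Set.Icc x (x + a) ×ˢ Set.Icc y (y + b)

namespace RectDissection

open MeasureTheory Matrix

/-- `F' ⊗ G'` integrates over a rectangle to the product of the increments of `F` and `G`. -/
lemma setIntegral_derivative_mul_derivative (F G : Polynomial ℝ) {x₀ x₁ y₀ y₁ : ℝ}
    (hx : x₀ ≤ x₁) (hy : y₀ ≤ y₁) :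
    ∫ z in Set.Icc x₀ x₁ ×ˢ Set.Icc y₀ y₁,
        (Polynomial.derivative F).eval z.1 * (Polynomial.derivative G).eval z.2 =
      (F.eval x₁ - F.eval x₀) * (G.eval y₁ - G.eval y₀) := by
  have key (H : Polynomial ℝ) {u v : ℝ} (huv : u ≤ v) :
      ∫ t in Set.Icc u v, (Polynomial.derivative H).eval t = H.eval v - H.eval u := by
    rw [integral_Icc_eq_integral_Ioc, ← intervalIntegral.integral_of_le huv]
    exact intervalIntegral.integral_eq_sub_of_hasDerivAt (fun t _ => H.hasDerivAt t)
      ((Polynomial.continuous _).intervalIntegrable _ _)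
  rw [Measure.volume_eq_prod, setIntegral_prod_mul (fun t => (Polynomial.derivative F).eval t)
    (fun t => (Polynomial.derivative G).eval t), key F hx, key G hy]

lemma exists_polynomial_eval_eq (s : Finset ℝ) (f : ℝ → ℝ) :
    ∃ F : Polynomial ℝ, ∀ t ∈ s, F.eval t = f t :=
  ⟨Lagrange.interpolate s id f, fun _ ht =>
    Lagrange.eval_interpolate_at_node (v := id) f Function.injective_id.injOn ht⟩

lemma aedisjoint_of_disjoint_interior {s t : Set (ℝ × ℝ)} (hs : Convex ℝ s) (ht : Convex ℝ t)
    (h : Disjoint (interior s) (interior t)) : AEDisjoint volume s t := by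
  have hsub : s ∩ t ⊆ frontier s ∪ frontier t := by
    rintro z ⟨hzs, hzt⟩
    by_contra hz
    simp only [Set.mem_union, not_or] at hz
    have h1 : z ∈ interior s := by
      by_contra h1; exact hz.1 ⟨subset_closure hzs, h1⟩
    have h2 : z ∈ interior t := by
      by_contra h2; exact hz.2 ⟨subset_closure hzt, h2⟩
    exact Set.disjoint_left.mp h h1 h2
  exact measure_mono_null hsub
    (measure_union_null (hs.addHaar_frontier volume) (ht.addHaar_frontier volume))

lemma convex_rectTile (x y : ℝ) (a b : ℕ) : Convex ℝ (rectTile x y a b) :=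
  (convex_Icc _ _).prod (convex_Icc _ _)

/-- The product of the increments of two arbitrary functions of one variable is additive over
rectangular dissections. -/
lemma sum_increment_mul_increment {M N n : ℕ} {x y : Fin n → ℝ} {a b : Fin n → ℕ}
    (hdisj : Pairwise fun i j =>
      Disjoint (interior (rectTile (x i) (y i) (a i) (b i)))
        (interior (rectTile (x j) (y j) (a j) (b j))))
    (hcover : (⋃ i, rectTile (x i) (y i) (a i) (b i)) =
      Set.Icc (0 : ℝ) M ×ˢ Set.Icc (0 : ℝ) N) (f g : ℝ → ℝ) :
    ∑ i, (f (x i + a i) - f (x i)) * (g (y i + b i) - g (y i)) =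
      (f M - f 0) * (g N - g 0) := by
  obtain ⟨F, hF⟩ := exists_polynomial_eval_eq
    ({0, (M : ℝ)} ∪ (Finset.univ.image x ∪ Finset.univ.image fun i => x i + a i)) f
  obtain ⟨G, hG⟩ := exists_polynomial_eval_eq
    ({0, (N : ℝ)} ∪ (Finset.univ.image y ∪ Finset.univ.image fun i => y i + b i)) g
  have hcont : Continuous fun z : ℝ × ℝ =>
      (Polynomial.derivative F).eval z.1 * (Polynomial.derivative G).eval z.2 :=
    ((Polynomial.continuous _).comp continuous_fst).mul
      ((Polynomial.continuous _).comp continuous_snd)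
  have hint := integral_iUnion_ae
    (s := fun i => rectTile (x i) (y i) (a i) (b i)) (μ := volume)
    (f := fun z : ℝ × ℝ =>
      (Polynomial.derivative F).eval z.1 * (Polynomial.derivative G).eval z.2)
    (fun i => (measurableSet_Icc.prod measurableSet_Icc).nullMeasurableSet)
    (fun i j hij => aedisjoint_of_disjoint_interior (convex_rectTile _ _ _ _)
      (convex_rectTile _ _ _ _) (hdisj hij))
    (by
      rw [hcover]
      exact hcont.continuousOn.integrableOn_compact (isCompact_Icc.prod isCompact_Icc))
  rw [hcover, tsum_fintype, setIntegral_derivative_mul_derivative F G M.cast_nonneg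
    N.cast_nonneg] at hint
  rw [hF M (by simp), hF 0 (by simp), hG N (by simp), hG 0 (by simp)] at hint
  rw [hint]
  refine Finset.sum_congr rfl fun i _ => ?_
  rw [rectTile, setIntegral_derivative_mul_derivative F G (by simp) (by simp),
    hF (x i) (by simp), hF (x i + a i) (by simp), hG (y i) (by simp), hG (y i + b i) (by simp)]

/-! ### Incidence matrices -/

/-- The integer vector with a single entry `1` at `o`, or the zero vector if `o` is `none`. -/
def unitVec {J : Type*} [DecidableEq J] (o : Option J) : J → ℤ :=
  fun j => if o = some j then 1 else 0

/-- The row of a reduced incidence matrix belonging to an arc from `s` to `t`, where the vertex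
`none` has been grounded. -/
def arcRow {J : Type*} [DecidableEq J] (t s : Option J) : J → ℤ := unitVec t - unitVec s

lemma unitVec_comp_succAbove {n : ℕ} (k : Fin (n + 1)) (o : Option (Fin (n + 1))) (j : Fin n) :
    unitVec o (k.succAbove j) = unitVec (o.bind (finSuccEquiv' k)) j := by
  have h : o = some (k.succAbove j) ↔ o.bind (finSuccEquiv' k) = some j := by
    cases o with
    | none => simp
    | some a =>
      rw [Option.bind_some, Option.some_inj, ← finSuccEquiv'_succAbove k j,
        (finSuccEquiv' k).apply_eq_iff_eq]
  simp only [unitVec, h]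

lemma abs_det_arcRow_fin_le_one (n : ℕ) (t s : Fin n → Option (Fin n)) :
    |(Matrix.of fun i => arcRow (t i) (s i)).det| ≤ 1 := by
  induction n with
  | zero => simp
  | succ n ih =>
    set A : Matrix (Fin (n + 1)) (Fin (n + 1)) ℤ := Matrix.of fun i => arcRow (t i) (s i) with hA
    by_cases h : ∀ i, ((t i).isSome ↔ (s i).isSome)
    · have h0 : A.det = 0 := by
        refine Matrix.exists_mulVec_eq_zero_iff.mp ⟨1, one_ne_zero, ?_⟩
        funext i
        have := h i
        rcases ht : t i with _ | u <;> rcases hs : s i with _ | v <;> simp [ht, hs] at this <;>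
          simp [hA, Matrix.mulVec, dotProduct, arcRow, unitVec, ht, hs]
      simp [h0]
    · push Not at h
      obtain ⟨i, hi⟩ := h
      obtain ⟨k, ε, hε, hk⟩ : ∃ (k : Fin (n + 1)) (ε : ℤ), |ε| = 1 ∧
          ∀ j, A i j = if k = j then ε else 0 := by
        rcases ht : t i with _ | u <;> rcases hs : s i with _ | v <;> simp [ht, hs] at hi
        · exact ⟨v, -1, by simp, fun j => by
            simp only [hA, Matrix.of_apply, arcRow, unitVec, ht, hs, Pi.sub_apply]
            by_cases hj : v = j <;> simp [hj]⟩
        · exact ⟨u, 1, by simp, fun j => by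
            simp only [hA, Matrix.of_apply, arcRow, unitVec, ht, hs, Pi.sub_apply]
            by_cases hj : u = j <;> simp [hj]⟩
      rw [Matrix.det_succ_row A i, Finset.sum_eq_single k (fun j _ hj => by
        simp [hk, Ne.symm hj]) (by simp), hk, if_pos rfl, abs_mul, abs_mul, abs_pow, abs_neg,
        abs_one, one_pow, hε, one_mul, one_mul]
      have hsub : A.submatrix i.succAbove k.succAbove = Matrix.of fun j =>
          arcRow ((t (i.succAbove j)).bind (finSuccEquiv' k))
            ((s (i.succAbove j)).bind (finSuccEquiv' k)) := by
        ext r c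
        simp [hA, arcRow, unitVec_comp_succAbove]
      rw [hsub]
      exact ih _ _

/-- Reduced incidence matrices of directed graphs are unimodular or singular. -/
lemma abs_det_arcRow_le_one {J : Type*} [Fintype J] [DecidableEq J] (t s : J → Option J) :
    |(Matrix.of fun i => arcRow (t i) (s i)).det| ≤ 1 := by
  let e := (Fintype.equivFin J).symm
  have h := abs_det_arcRow_fin_le_one _ (fun i => (t (e i)).map e.symm)
    (fun i => (s (e i)).map e.symm)
  have hmap (o : Option J) (j : Fin (Fintype.card J)) :
      unitVec o (e j) = unitVec (o.map e.symm) j := by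
    cases o <;> simp [unitVec, Equiv.symm_apply_eq]
  have hsub : (Matrix.of fun i => arcRow (t i) (s i)).submatrix e e = Matrix.of fun i =>
      arcRow ((t (e i)).map e.symm) ((s (e i)).map e.symm) := by
    ext r c
    simp [arcRow, hmap]
  rw [← Matrix.det_submatrix_equiv_self e, hsub]
  exact h

/-! ### Expanding a determinant along two-part rows -/

section Splitting

/-- The rows of a matrix in which the row `e` is `w true e • v true e + w false e • v false e`
while `e` is unresolved, and `v b e` once `e` has been resolved to `b`. -/
def splitRow {J : Type*} (v : Bool → J → J → ℤ) (w : Bool → J → ℕ) (σ : J → Option Bool)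
    (e : J) : J → ℤ :=
  match σ e with
  | none => (w true e : ℤ) • v true e + (w false e : ℤ) • v false e
  | some b => v b e

variable {J : Type*} [Fintype J]

/-- The rows which are not yet resolved. -/
def unresolved (σ : J → Option Bool) : Finset J := Finset.univ.filter fun e => σ e = none

lemma mem_unresolved {σ : J → Option Bool} {e : J} : e ∈ unresolved σ ↔ σ e = none := by
  simp [unresolved]

variable [DecidableEq J]

lemma unresolved_update {σ : J → Option Bool} {e : J} (b : Bool) :
    unresolved (Function.update σ e (some b)) = (unresolved σ).erase e := by
  ext r
  by_cases hr : r = e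
  · subst hr; simp [mem_unresolved]
  · simp [mem_unresolved, hr]

omit [Fintype J] in
lemma splitRow_update (v : Bool → J → J → ℤ) (w : Bool → J → ℕ) (σ : J → Option Bool) (e : J)
    (b : Bool) : Matrix.of (splitRow v w (Function.update σ e (some b))) =
      (Matrix.of (splitRow v w σ)).updateRow e (v b e) := by
  ext r c
  by_cases hr : r = e
  · subst hr; simp [splitRow]
  · simp [splitRow, hr]

/-- Resolving one row. -/
lemma abs_det_splitRow_le (v : Bool → J → J → ℤ) (w : Bool → J → ℕ) {σ : J → Option Bool} {e : J}
    (he : σ e = none) (b : Bool) : |(Matrix.of (splitRow v w σ)).det| ≤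
      w (!b) e * |(Matrix.of (splitRow v w (Function.update σ e (some (!b))))).det| +
      w b e * |(Matrix.of (splitRow v w (Function.update σ e (some b)))).det| := by
  have h : Matrix.of (splitRow v w σ) = (Matrix.of (splitRow v w σ)).updateRow e
      ((w (!b) e : ℤ) • v (!b) e + (w b e : ℤ) • v b e) := by
    ext r c
    by_cases hr : r = e
    · subst hr; cases b <;> simp [splitRow, he, add_comm]
    · simp [hr]
  rw [h, Matrix.det_updateRow_add, Matrix.det_updateRow_smul, Matrix.det_updateRow_smul,
    splitRow_update, splitRow_update]
  refine (abs_add_le _ _).trans (le_of_eq ?_)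
  simp [abs_mul]

/-- If resolving all rows of `Z` to `b` makes the determinant vanish, resolve these rows one at
a time. -/
lemma abs_det_le_of_cut (v : Bool → J → J → ℤ) (w : Bool → J → ℕ) (W : J → ℝ) {τ : ℝ}
    (hτ : 0 < τ) (b : Bool) (Z : Finset J) (σ : J → Option Bool)
    (hZ : Z ⊆ unresolved σ) (hunit : ∀ e ∈ Z, w true e = 1 ∧ w false e = 1 ∧ W e = τ)
    (hcut : ∀ σ' : J → Option Bool, (∀ e ∉ Z, σ' e = σ e) → (∀ e ∈ Z, σ' e = some b) →
      (Matrix.of (splitRow v w σ')).det = 0)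
    (ih : ∀ σ' : J → Option Bool, (unresolved σ').card < (unresolved σ).card →
      (|(Matrix.of (splitRow v w σ')).det| : ℝ) ≤ ∏ e ∈ unresolved σ', W e) :
    (|(Matrix.of (splitRow v w σ)).det| : ℝ) ≤
      (∑ i ∈ Finset.range Z.card, (τ⁻¹) ^ (i + 1)) * ∏ e ∈ unresolved σ, W e := by
  induction Z using Finset.induction_on generalizing σ with
  | empty => simp [hcut σ (by simp) (by simp)]
  | insert e Z heZ IH =>
    have he : e ∈ unresolved σ := hZ (Finset.mem_insert_self e Z)
    obtain ⟨hw1, hw0, hW⟩ := hunit e (Finset.mem_insert_self e Z)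
    have hcard (c : Bool) : (unresolved (Function.update σ e (some c))).card <
        (unresolved σ).card := by
      rw [unresolved_update]; exact Finset.card_erase_lt_of_mem he
    have hprod : ∏ r ∈ unresolved σ, W r = τ * ∏ r ∈ (unresolved σ).erase e, W r := by
      rw [← Finset.mul_prod_erase _ _ he, hW]
    have h1 := ih _ (hcard (!b))
    have h2 := IH (Function.update σ e (some b))
      (by
        rw [unresolved_update]
        exact fun r hr => Finset.mem_erase.mpr
          ⟨fun h => heZ (h ▸ hr), hZ (Finset.mem_insert_of_mem hr)⟩)
      (fun r hr => hunit r (Finset.mem_insert_of_mem hr))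
      (fun σ' h h' => hcut σ'
        (fun r hr => by
          rw [Finset.mem_insert, not_or] at hr
          rw [h r hr.2, Function.update_of_ne hr.1])
        (fun r hr => by
          rcases Finset.mem_insert.mp hr with rfl | hr
          · rw [h r heZ, Function.update_self]
          · exact h' r hr))
      (fun σ' h => ih σ' (h.trans (hcard b)))
    have h3 : (|(Matrix.of (splitRow v w σ)).det| : ℝ) ≤
        |((Matrix.of (splitRow v w (Function.update σ e (some (!b))))).det : ℝ)| +
        |((Matrix.of (splitRow v w (Function.update σ e (some b)))).det : ℝ)| := by
      have h := abs_det_splitRow_le v w (mem_unresolved.mp he) b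
      have hwb (c : Bool) : w c e = 1 := by cases c <;> assumption
      rw [hwb, hwb, Nat.cast_one, one_mul, one_mul] at h
      exact_mod_cast h
    rw [unresolved_update] at h1 h2
    rw [Finset.card_insert_of_notMem heZ, Finset.sum_range_succ', hprod]
    calc _ ≤ _ := h3
      _ ≤ _ := add_le_add h1 h2
      _ = _ := by
        have h4 : ∑ i ∈ Finset.range Z.card, τ⁻¹ ^ (i + 1 + 1) =
            (∑ i ∈ Finset.range Z.card, τ⁻¹ ^ (i + 1)) * τ⁻¹ := by
          rw [Finset.sum_mul]; exact Finset.sum_congr rfl fun i _ => pow_succ _ _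
        rw [h4]
        linear_combination (-(∏ r ∈ (unresolved σ).erase e, W r) *
          (1 + ∑ i ∈ Finset.range Z.card, τ⁻¹ ^ (i + 1))) * mul_inv_cancel₀ hτ.ne'

lemma add_le_pow_max {τ : ℝ} (hτ : 9 / 5 ≤ τ) {p q : ℕ} (hpq : p.Coprime q) (hp : 0 < p)
    (hq : 0 < q) (h : ¬(p = 1 ∧ q = 1)) : (p + q : ℝ) ≤ τ ^ max p q := by
  have hne : p ≠ q := by
    rintro rfl
    rw [Nat.coprime_self] at hpq
    exact h ⟨hpq, hpq⟩
  have hpow (m : ℕ) : (2 * (m + 2) - 1 : ℝ) ≤ τ ^ (m + 2) := by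
    induction m with
    | zero => norm_num; nlinarith
    | succ m ih =>
      have hm : (0 : ℝ) ≤ m := m.cast_nonneg
      rw [show m + 1 + 2 = m + 2 + 1 by ring, pow_succ]
      push_cast
      nlinarith [mul_le_mul ih hτ (by norm_num) ((by linarith : (0 : ℝ) ≤ _).trans ih)]
  obtain ⟨m, hm⟩ : ∃ m, max p q = m + 2 := ⟨max p q - 2, by omega⟩
  have hle : p + q + 1 ≤ 2 * (m + 2) := by omega
  have hle' : (p + q + 1 : ℝ) ≤ 2 * (m + 2) := by exact_mod_cast hle
  rw [hm]
  linarith [hpow m]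

lemma abs_det_splitRow_le_prod (v : Bool → J → J → ℤ) (w : Bool → J → ℕ) {τ : ℝ}
    (hτ : 9 / 5 ≤ τ) (hτ3 : τ ^ 2 + τ + 1 ≤ τ ^ 3) (hpos : ∀ b e, 0 < w b e)
    (hcop : ∀ e, (w true e).Coprime (w false e))
    (hbase : ∀ σ : J → Option Bool, unresolved σ = ∅ → |(Matrix.of (splitRow v w σ)).det| ≤ 1)
    (hcut : ∀ σ : J → Option Bool, (unresolved σ).Nonempty →
      ∃ b, ∃ Z ⊆ unresolved σ, Z.card ≤ 3 ∧ ∀ σ' : J → Option Bool,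
        (∀ e ∉ Z, σ' e = σ e) → (∀ e ∈ Z, σ' e = some b) →
          (Matrix.of (splitRow v w σ')).det = 0) (σ : J → Option Bool) :
    (|(Matrix.of (splitRow v w σ)).det| : ℝ) ≤
      ∏ e ∈ unresolved σ, τ ^ max (w true e) (w false e) := by
  induction h : (unresolved σ).card using Nat.strong_induction_on generalizing σ with
  | _ k IH =>
  subst h
  have hτ0 : 0 < τ := by linarith
  rcases (unresolved σ).eq_empty_or_nonempty with h0 | h0
  · rw [h0, Finset.prod_empty]; exact_mod_cast hbase σ h0
  by_cases hunit : ∀ e ∈ unresolved σ, w true e = 1 ∧ w false e = 1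
  · obtain ⟨b, Z, hZ, hZ3, hdet⟩ := hcut σ h0
    refine (abs_det_le_of_cut v w _ hτ0 b Z σ hZ
      (fun e he => ⟨(hunit e (hZ he)).1, (hunit e (hZ he)).2, by simp [hunit e (hZ he)]⟩) hdet
      (fun σ' h => IH _ h σ' rfl)).trans ?_
    refine mul_le_of_le_one_left (Finset.prod_nonneg fun e _ => by positivity) ?_
    calc ∑ i ∈ Finset.range Z.card, (τ⁻¹) ^ (i + 1)
        ≤ ∑ i ∈ Finset.range 3, (τ⁻¹) ^ (i + 1) :=
          Finset.sum_le_sum_of_subset_of_nonneg (Finset.range_mono hZ3)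
            fun i _ _ => by positivity
      _ = (τ ^ 2 + τ + 1) / τ ^ 3 := by
          rw [eq_div_iff (by positivity)]
          simp only [Finset.sum_range_succ, Finset.sum_range_zero]
          linear_combination (τ ^ 2 + τ * (τ * τ⁻¹ + 1) + ((τ * τ⁻¹) ^ 2 + τ * τ⁻¹ + 1)) *
            mul_inv_cancel₀ hτ0.ne'
      _ ≤ 1 := (div_le_one (by positivity)).mpr hτ3
  · push Not at hunit
    obtain ⟨e, he, hne⟩ := hunit
    have hIH (c : Bool) : (|(Matrix.of (splitRow v w (Function.update σ e (some c)))).det| : ℝ) ≤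
        ∏ r ∈ (unresolved σ).erase e, τ ^ max (w true r) (w false r) := by
      rw [← unresolved_update c]
      exact IH _ (by rw [unresolved_update]; exact Finset.card_erase_lt_of_mem he) _ rfl
    have hsplit : (|(Matrix.of (splitRow v w σ)).det| : ℝ) ≤
        w true e * |((Matrix.of (splitRow v w (Function.update σ e (some true)))).det : ℝ)| +
        w false e * |((Matrix.of (splitRow v w (Function.update σ e (some false)))).det : ℝ)| := by
      exact_mod_cast abs_det_splitRow_le v w (mem_unresolved.mp he) false
    have hprod : 0 ≤ ∏ r ∈ (unresolved σ).erase e, τ ^ max (w true r) (w false r) :=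
      Finset.prod_nonneg fun e _ => by positivity
    rw [← Finset.mul_prod_erase _ _ he]
    calc _ ≤ _ := hsplit
      _ ≤ _ := add_le_add (mul_le_mul_of_nonneg_left (hIH true) (Nat.cast_nonneg _))
        (mul_le_mul_of_nonneg_left (hIH false) (Nat.cast_nonneg _))
      _ = ((w true e : ℝ) + w false e) *
          ∏ r ∈ (unresolved σ).erase e, τ ^ max (w true r) (w false r) := by ring
      _ ≤ _ := mul_le_mul_of_nonneg_right
        (add_le_pow_max hτ (hcop e) (hpos true e) (hpos false e) fun h => hne h.1 h.2) hprod

lemma det_splitRow_eq_zero (v : Bool → J → J → ℤ) (w : Bool → J → ℕ) {σ : J → Option Bool}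
    (b : Bool) {c : J → ℤ} (hc : c ≠ 0) (hb : ∀ e, v b e ⬝ᵥ c = 0)
    (hb' : ∀ e, σ e ≠ some b → v (!b) e ⬝ᵥ c = 0) :
    (Matrix.of (splitRow v w σ)).det = 0 := by
  refine Matrix.exists_mulVec_eq_zero_iff.mp ⟨c, hc, ?_⟩
  funext e
  change splitRow v w σ e ⬝ᵥ c = 0
  have h1 := hb e
  rcases h : σ e with _ | r
  · have h2 := hb' e (by simp [h])
    cases b <;> simp only [Bool.not_true, Bool.not_false] at h2 <;>
      simp only [splitRow, h, add_dotProduct, smul_dotProduct, h1, h2, smul_zero, add_zero]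
  · have h2 := hb' e
    rw [h] at h2
    cases b <;> cases r <;> simp_all [splitRow]

end Splitting

/-! ### Cuts with few arcs in a pair of graphs -/

section Cuts

variable {E V : Type*} [DecidableEq E] [DecidableEq V]

/-- A graph on `V` has at least `|V|` minus its number of arcs many components. -/
lemma exists_labelling [Fintype V] (t s : E → V) (T : Finset E) :
    ∃ φ : V → V, (∀ e ∈ T, φ (t e) = φ (s e)) ∧
      Fintype.card V ≤ (Finset.univ.image φ).card + T.card := by
  induction T using Finset.induction_on with
  | empty => exact ⟨id, by simp, by simp⟩
  | insert e T heT ih =>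
    obtain ⟨φ, hφ, hcard⟩ := ih
    let m : V → V := fun l => if l = φ (t e) then φ (s e) else l
    refine ⟨m ∘ φ, ?_, ?_⟩
    · intro r hr
      rcases Finset.mem_insert.mp hr with rfl | hr
      · simp [m]
      · simp [hφ r hr]
    · have hsub : (Finset.univ.image φ).erase (φ (t e)) ⊆ Finset.univ.image (m ∘ φ) := by
        intro l hl
        obtain ⟨hne, hl⟩ := Finset.mem_erase.mp hl
        obtain ⟨u, -, rfl⟩ := Finset.mem_image.mp hl
        exact Finset.mem_image.mpr ⟨u, Finset.mem_univ _, by simp [m, hne]⟩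
      have h1 := Finset.card_le_card hsub
      rw [Finset.card_erase_of_mem (Finset.mem_image_of_mem _ (Finset.mem_univ _))] at h1
      rw [Finset.card_insert_of_notMem heT]
      omega

/-- The arcs in `U` with exactly one endpoint labelled `l`. -/
def crossing (t s : E → V) (U : Finset E) (l : V) : Finset E :=
  U.filter fun e => ¬(t e = l ↔ s e = l)

omit [DecidableEq E] in
lemma sum_card_crossing_le (t s : E → V) (U : Finset E) (L : Finset V) :
    ∑ l ∈ L, (crossing t s U l).card ≤ 2 * U.card := by
  have h : ∑ l ∈ L, (crossing t s U l).card = _ :=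
    Finset.sum_card_bipartiteAbove_eq_sum_card_bipartiteBelow
      fun l e => ¬(t e = l ↔ s e = l)
  rw [h, mul_comm, ← smul_eq_mul]
  refine Finset.sum_le_card_nsmul _ _ _ fun e _ => ?_
  refine (Finset.card_le_card (t := {t e, s e}) fun l hl => ?_).trans Finset.card_le_two
  have := (Finset.mem_filter.mp hl).2
  simp only [Finset.mem_insert, Finset.mem_singleton]
  by_contra! h
  exact this ⟨fun h' => absurd h'.symm h.1, fun h' => absurd h'.symm h.2⟩

omit [DecidableEq E] in
lemma exists_small_crossing {V' : Type*} [DecidableEq V'] (t s : E → V) (t' s' : E → V')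
    {U : Finset E} (hU : U.Nonempty) {L : Finset V} {L' : Finset V'} (hL : L.Nonempty)
    (hL' : L'.Nonempty) (hcard : U.card + 2 ≤ L.card + L'.card) :
    (1 < L.card ∧ ∃ l ∈ L, (crossing t s U l).card ≤ 3) ∨
      (1 < L'.card ∧ ∃ l ∈ L', (crossing t' s' U l).card ≤ 3) := by
  have h1 := sum_card_crossing_le t s U L
  have h2 := sum_card_crossing_le t' s' U L'
  have hU := hU.card_pos
  have hL := hL.card_pos
  have hL' := hL'.card_pos
  by_contra! h
  have h3 (hlt : 1 < L.card) : L.card * 4 ≤ ∑ l ∈ L, (crossing t s U l).card := by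
    rw [← smul_eq_mul]; exact Finset.card_nsmul_le_sum _ _ _ (h.1 hlt)
  have h4 (hlt : 1 < L'.card) : L'.card * 4 ≤ ∑ l ∈ L', (crossing t' s' U l).card := by
    rw [← smul_eq_mul]; exact Finset.card_nsmul_le_sum _ _ _ (h.2 hlt)
  by_cases hc : 1 < L.card <;> by_cases hc' : 1 < L'.card
  · have := h3 hc; have := h4 hc'; omega
  · have := h3 hc; omega
  · have := h4 hc'; omega
  · omega

end Cuts

/-! ### Determinants attached to a pair of graphs -/

section PairOfGraphs

variable {P Q : Type*} [Fintype P] [Fintype Q] [DecidableEq P] [DecidableEq Q]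

lemma dotProduct_unitVec {J : Type*} [Fintype J] [DecidableEq J] (o : Option J) (c : J → ℤ) :
    unitVec o ⬝ᵥ c = o.elim 0 c := by
  cases o <;> simp [unitVec, dotProduct]

lemma dotProduct_arcRow {J : Type*} [Fintype J] [DecidableEq J] (t s : Option J) (c : J → ℤ) :
    arcRow t s ⬝ᵥ c = t.elim 0 c - s.elim 0 c := by
  rw [arcRow, sub_dotProduct, dotProduct_unitVec, dotProduct_unitVec]

/-- The potential of a labelled vertex: the indicator of the label `l`, normalised to vanish at
the grounded vertex. -/
def cutPotential {V W : Type*} [DecidableEq W] (φ : Option V → W) (l : W) (o : Option V) : ℤ :=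
  (if φ o = l then 1 else 0) - if φ none = l then 1 else 0

lemma cutPotential_eq_of_not_crossing {E V W : Type*} [DecidableEq W] {φ : Option V → W} {l : W}
    {t s : E → Option V} {e : E} (h : φ (t e) = l ↔ φ (s e) = l) :
    cutPotential φ l (t e) = cutPotential φ l (s e) := by
  simp only [cutPotential, h]

lemma exists_cutPotential_ne_zero {V W : Type*} [Fintype V] [DecidableEq W] {φ : Option V → W}
    {l : W} (hl : l ∈ Finset.univ.image φ) (hcard : 1 < (Finset.univ.image φ).card) :
    ∃ u, cutPotential φ l (some u) ≠ 0 := by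
  obtain ⟨m, hm, hne⟩ := Finset.exists_mem_ne hcard l
  obtain ⟨o, -, ho⟩ := Finset.mem_image.mp hl
  obtain ⟨o', -, ho'⟩ := Finset.mem_image.mp hm
  by_cases h0 : φ none = l
  · cases o' with
    | none => exact absurd (ho'.symm.trans h0) hne
    | some u => exact ⟨u, by simp [cutPotential, h0, ho', hne]⟩
  · cases o with
    | none => exact absurd ho h0
    | some u => exact ⟨u, by simp [cutPotential, h0, ho]⟩

/-- The rows of the reduced incidence matrices of two graphs, put side by side. -/
def pairRow {E : Type*} (t s : E → Option P) (t' s' : E → Option Q) :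
    Bool → E → P ⊕ Q → ℤ
  | true, e => arcRow ((t e).map Sum.inl) ((s e).map Sum.inl)
  | false, e => arcRow ((t' e).map Sum.inr) ((s' e).map Sum.inr)

/-- A determinant in which every row is a weighted sum of an arc row of one graph and an arc row
of another graph. -/
lemma abs_det_pairRow_le (t s : P ⊕ Q → Option P) (t' s' : P ⊕ Q → Option Q)
    (w : Bool → P ⊕ Q → ℕ) {τ : ℝ} (hτ : 9 / 5 ≤ τ) (hτ3 : τ ^ 2 + τ + 1 ≤ τ ^ 3)
    (hpos : ∀ b e, 0 < w b e) (hcop : ∀ e, (w true e).Coprime (w false e)) :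
    (|(Matrix.of fun e => (w true e : ℤ) • pairRow t s t' s' true e +
      (w false e : ℤ) • pairRow t s t' s' false e).det| : ℝ) ≤
      ∏ e, τ ^ max (w true e) (w false e) := by
  have main := abs_det_splitRow_le_prod (pairRow t s t' s') w hτ hτ3 hpos hcop ?_ ?_
    fun _ => none
  · rw [show unresolved (fun _ : P ⊕ Q => none) = Finset.univ by simp [unresolved]] at main
    exact main
  · intro σ hσ
    have hres (e : P ⊕ Q) : σ e ≠ none := fun h => by
      have := mem_unresolved.mpr h
      simp [hσ] at this
    have hrow : splitRow (pairRow t s t' s') w σ = fun e =>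
        arcRow (if σ e = some true then (t e).map Sum.inl else (t' e).map Sum.inr)
          (if σ e = some true then (s e).map Sum.inl else (s' e).map Sum.inr) := by
      funext e
      rcases h : σ e with _ | _ | _
      · exact absurd h (hres e)
      · simp [splitRow, h, pairRow]
      · simp [splitRow, h, pairRow]
    rw [hrow]
    exact abs_det_arcRow_le_one _ _
  · intro σ hσ
    obtain ⟨φ, hφ, hφcard⟩ := exists_labelling t s (Finset.univ.filter fun e => σ e = some true)
    obtain ⟨ψ, hψ, hψcard⟩ :=
      exists_labelling t' s' (Finset.univ.filter fun e => σ e = some false)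
    simp only [Finset.mem_filter, Finset.mem_univ, true_and] at hφ hψ
    have hcount : (Finset.univ.filter fun e => σ e = some true).card +
        (Finset.univ.filter fun e => σ e = some false).card + (unresolved σ).card =
        Fintype.card P + Fintype.card Q := by
      rw [← Fintype.card_sum, ← Finset.card_univ, unresolved, ← Finset.card_union_of_disjoint,
        ← Finset.card_union_of_disjoint]
      · congr 1
        ext e
        rcases h : σ e with _ | _ | _ <;> simp [h]
      · rw [Finset.disjoint_left]; intro e; rcases h : σ e with _ | _ | _ <;> simp [h]
      · rw [Finset.disjoint_left]; intro e; rcases h : σ e with _ | _ | _ <;> simp [h]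
    rw [Fintype.card_option] at hφcard hψcard
    rcases exists_small_crossing (φ ∘ t) (φ ∘ s) (ψ ∘ t') (ψ ∘ s') hσ
      (Finset.univ_nonempty.image φ) (Finset.univ_nonempty.image ψ) (by omega) with
      ⟨hcard, l, hl, h3⟩ | ⟨hcard, l, hl, h3⟩
    · refine ⟨false, _, Finset.filter_subset _ _, h3, fun σ' hσ' hZ => ?_⟩
      obtain ⟨u, hu⟩ := exists_cutPotential_ne_zero hl hcard
      refine det_splitRow_eq_zero _ w false
        (c := Sum.elim (fun u => cutPotential φ l (some u)) 0)
        (fun h => hu (congrFun h (Sum.inl u))) (fun e => ?_) fun e he => ?_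
      · rw [pairRow, dotProduct_arcRow]
        rcases t' e with _ | _ <;> rcases s' e with _ | _ <;> simp
      · have heZ : e ∉ crossing (φ ∘ t) (φ ∘ s) (unresolved σ) l := fun h => he (hZ e h)
        rw [hσ' e heZ] at he
        rw [Bool.not_false, pairRow, dotProduct_arcRow]
        have hcross : φ (t e) = l ↔ φ (s e) = l := by
          rcases h : σ e with _ | _ | _
          · by_contra hc
            exact heZ (Finset.mem_filter.mpr ⟨mem_unresolved.mpr h, hc⟩)
          · exact absurd h he
          · rw [hφ e h]
        have hpot := cutPotential_eq_of_not_crossing hcross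
        rcases ht : t e with _ | _ <;> rcases hs : s e with _ | _ <;>
          simp_all [cutPotential]
    · refine ⟨true, _, Finset.filter_subset _ _, h3, fun σ' hσ' hZ => ?_⟩
      obtain ⟨u, hu⟩ := exists_cutPotential_ne_zero hl hcard
      refine det_splitRow_eq_zero _ w true
        (c := Sum.elim 0 fun u => cutPotential ψ l (some u))
        (fun h => hu (congrFun h (Sum.inr u))) (fun e => ?_) fun e he => ?_
      · rw [pairRow, dotProduct_arcRow]
        rcases t e with _ | _ <;> rcases s e with _ | _ <;> simp
      · have heZ : e ∉ crossing (ψ ∘ t') (ψ ∘ s') (unresolved σ) l := fun h => he (hZ e h)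
        rw [hσ' e heZ] at he
        rw [Bool.not_true, pairRow, dotProduct_arcRow]
        have hcross : ψ (t' e) = l ↔ ψ (s' e) = l := by
          rcases h : σ e with _ | _ | _
          · by_contra hc
            exact heZ (Finset.mem_filter.mpr ⟨mem_unresolved.mpr h, hc⟩)
          · rw [hψ e h]
          · exact absurd h he
        have hpot := cutPotential_eq_of_not_crossing hcross
        rcases ht : t' e with _ | _ <;> rcases hs : s' e with _ | _ <;>
          simp_all [cutPotential]

end PairOfGraphs

/-! ### The linear system of a dissection -/

section Kernel

variable {n : ℕ} {x y : Fin n → ℝ} {a b : Fin n → ℕ} {M N : ℝ}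

/-- A balanced perturbation of the coordinates of a dissection is trivial. -/
lemma eq_zero_of_balanced (ha : ∀ i, 0 < a i) (hb : ∀ i, 0 < b i)
    (hadd : ∀ f g : ℝ → ℝ, ∑ i, (f (x i + a i) - f (x i)) * (g (y i + b i) - g (y i)) =
      (f M - f 0) * (g N - g 0))
    {p q : Fin n → ℕ} (hp : ∀ i, 0 < p i) (hq : ∀ i, 0 < q i) {f g : ℝ → ℝ}
    (hf0 : f 0 = 0) (hfM : f M = 0) (hg0 : g 0 = 0)
    (hfg : ∀ i, (q i : ℝ) * (f (x i + a i) - f (x i)) = p i * (g (y i + b i) - g (y i)))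
    (i : Fin n) : (f (x i) = 0 ∧ f (x i + a i) = 0) ∧ g (y i) = 0 ∧ g (y i + b i) = 0 := by
  have hp' (i) : (0 : ℝ) < p i := Nat.cast_pos.mpr (hp i)
  have hq' (i) : (0 : ℝ) < q i := Nat.cast_pos.mpr (hq i)
  have ha' (i) : (0 : ℝ) < a i := Nat.cast_pos.mpr (ha i)
  have hb' (i) : (0 : ℝ) < b i := Nat.cast_pos.mpr (hb i)
  have hg (i) : g (y i + b i) - g (y i) = q i / p i * (f (x i + a i) - f (x i)) := by
    have := (hp' i).ne'
    field_simp
    linarith [hfg i]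
  have hsum := hadd f g
  rw [hf0, hfM, sub_zero, zero_mul, Finset.sum_eq_zero_iff_of_nonneg] at hsum
  · have hf' (i) : f (x i + a i) = f (x i) := by
      have h := hsum i (Finset.mem_univ i)
      rw [hg i] at h
      have h3 : (q i / p i : ℝ) ≠ 0 := (div_pos (hq' i) (hp' i)).ne'
      have h4 : f (x i + a i) - f (x i) = 0 := by
        rcases mul_eq_zero.mp h with h | h
        · exact h
        · exact (mul_eq_zero.mp h).resolve_left h3
      linarith
    have hg' (i) : g (y i + b i) = g (y i) := by
      have := hg i
      rw [hf' i, sub_self, mul_zero] at this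
      linarith
    have hx : ∑ i, f (x i) ^ 2 * (a i * b i) = 0 := by
      calc _ = ∑ i, ((x i + a i) * f (x i + a i) ^ 2 - x i * f (x i) ^ 2) *
            ((y i + b i) - y i) := Finset.sum_congr rfl fun i _ => by rw [hf' i]; ring
        _ = 0 := (hadd (fun t => t * f t ^ 2) id).trans (by simp [hfM])
    have hy : ∑ i, g (y i) ^ 2 * (a i * b i) = 0 := by
      calc _ = ∑ i, ((x i + a i) - x i) *
            ((y i + b i - N) * g (y i + b i) ^ 2 - (y i - N) * g (y i) ^ 2) :=
              Finset.sum_congr rfl fun i _ => by rw [hg' i]; ring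
        _ = 0 := (hadd id fun t => (t - N) * g t ^ 2).trans (by simp [hg0])
    have hab (i) : (0 : ℝ) < a i * b i := mul_pos (ha' i) (hb' i)
    have hzero {h : Fin n → ℝ} (hs : ∑ i, h i ^ 2 * (a i * b i) = 0) (i : Fin n) : h i = 0 := by
      have h1 := (Finset.sum_eq_zero_iff_of_nonneg
        fun j _ => mul_nonneg (sq_nonneg (h j)) (hab j).le).mp hs i (Finset.mem_univ i)
      exact pow_eq_zero_iff two_ne_zero |>.mp ((mul_eq_zero.mp h1).resolve_right (hab i).ne')
    rw [hf', hg', hzero hx i, hzero hy i]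
    simp
  · intro i _
    rw [hg i]
    have := div_nonneg (hq' i).le (hp' i).le
    nlinarith [mul_nonneg this (sq_nonneg (f (x i + a i) - f (x i)))]

end Kernel

/-- A matrix with trivial kernel has an invertible square submatrix. -/
lemma exists_injective_det_submatrix_ne_zero {m J : Type*} [Fintype m] [Fintype J] [DecidableEq J]
    (K : Matrix m J ℤ)
    (hK : ∀ c : J → ℝ, (∀ i, ∑ j, (K i j : ℝ) * c j = 0) → c = 0) :
    ∃ e : J → m, Function.Injective e ∧ (K.submatrix e id).det ≠ 0 := by
  let A : Matrix m J ℝ := K.map (Int.cast : ℤ → ℝ)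
  have hrank : A.rank = Fintype.card J := by
    have hinj : LinearIndependent ℝ A.col := by
      rw [← Matrix.mulVec_injective_iff]
      intro c c' h
      rw [← sub_eq_zero]
      refine hK _ fun i => ?_
      have h := congrFun h i
      simp only [Matrix.mulVec, dotProduct, A, Matrix.map_apply] at h
      simp [mul_sub, h]
    rw [← Matrix.rank_transpose]
    exact hinj.rank_matrix
  obtain ⟨κ, u, hu, hspan, hind⟩ := exists_linearIndependent' ℝ A.row
  have : Fintype κ := Fintype.ofInjective u hu
  have hcard : Fintype.card J = Fintype.card κ := by
    rw [← hrank, Matrix.rank_eq_finrank_span_row, ← hspan, finrank_span_eq_card hind]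
  let e := Fintype.equivOfCardEq hcard
  refine ⟨u ∘ e, hu.comp e.injective, ?_⟩
  have hrows : LinearIndependent ℝ (A.submatrix (u ∘ e) id).row := hind.comp e e.injective
  have hdet := (Matrix.isUnit_iff_isUnit_det _).mp
    (Matrix.linearIndependent_rows_iff_isUnit.mp hrows)
  intro h
  apply hdet.ne_zero
  have : A.submatrix (u ∘ e) id = (K.submatrix (u ∘ e) id).map (Int.castRingHom ℝ) := rfl
  rw [this, ← RingHom.mapMatrix_apply, ← RingHom.map_det, h, map_zero]

/-- Cramer's rule: if an integer system with right-hand side in `M ℤ` has a solution `c`, then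
`det A • c` has entries in `M ℤ`. -/
lemma exists_det_mul_eq {J : Type*} [Fintype J] [DecidableEq J] (A : Matrix J J ℤ) (M : ℝ)
    (c : J → ℝ) (r : J → ℤ) (h : ∀ i, ∑ j, (A i j : ℝ) * c j = M * r i) (j : J) :
    ∃ z : ℤ, A.det * c j = M * z := by
  let B : Matrix J J ℝ := A.map (Int.castRingHom ℝ)
  have h1 : B *ᵥ c = M • fun i => (r i : ℝ) := funext h
  have h2 : B.det • c = M • (B.adjugate *ᵥ fun i => (r i : ℝ)) := by
    rw [← Matrix.mulVec_smul, ← h1, Matrix.mulVec_mulVec, Matrix.adjugate_mul, Matrix.smul_mulVec,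
      Matrix.one_mulVec]
  have hdet : B.det = (A.det : ℝ) := (RingHom.map_det (Int.castRingHom ℝ) A).symm
  have hadj : B.adjugate = A.adjugate.map (Int.castRingHom ℝ) :=
    (RingHom.map_adjugate (Int.castRingHom ℝ) A).symm
  refine ⟨(A.adjugate *ᵥ r) j, ?_⟩
  have h3 := congrFun h2 j
  rw [hdet, hadj] at h3
  simpa [Matrix.mulVec, dotProduct] using h3

/-! ### The bound for dissections -/

/-- The vertex belonging to a coordinate `z`; coordinates outside `S` are grounded. -/
noncomputable def toVertex (S : Finset ℝ) (z : ℝ) : Option S :=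
  if h : z ∈ S then some ⟨z, h⟩ else none

lemma toVertex_elim (S : Finset ℝ) (h : ℝ → ℝ) (z : ℝ) :
    ((toVertex S z).elim 0 fun u : S => h u) = if z ∈ S then h z else 0 := by
  by_cases hz : z ∈ S <;> simp [toVertex, hz]

lemma sum_unitVec_mul {J : Type*} [Fintype J] [DecidableEq J] (o : Option J) (c : J → ℝ) :
    ∑ j, (unitVec o j : ℝ) * c j = o.elim 0 c := by
  cases o <;> simp [unitVec]

lemma sum_weighted_pairRow_mul {E P Q : Type*} [Fintype P] [Fintype Q] [DecidableEq P]
    [DecidableEq Q] (t s : E → Option P) (t' s' : E → Option Q) (k l : ℕ) (e : E)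
    (c : P ⊕ Q → ℝ) :
    ∑ j, ((((k : ℤ) • pairRow t s t' s' true e + (l : ℤ) • pairRow t s t' s' false e) j : ℤ) : ℝ) *
        c j =
      k * ((t e).elim 0 (c ∘ Sum.inl) - (s e).elim 0 (c ∘ Sum.inl)) +
      l * ((t' e).elim 0 (c ∘ Sum.inr) - (s' e).elim 0 (c ∘ Sum.inr)) := by
  have h1 (o : Option P) : (o.map Sum.inl).elim 0 c = o.elim 0 (c ∘ Sum.inl) := by
    cases o <;> rfl
  have h2 (o : Option Q) : (o.map Sum.inr).elim 0 c = o.elim 0 (c ∘ Sum.inr) := by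
    cases o <;> rfl
  rw [← h1, ← h1, ← h2, ← h2]
  simp only [← sum_unitVec_mul, ← Finset.sum_sub_distrib, Finset.mul_sum,
    ← Finset.sum_add_distrib]
  refine Finset.sum_congr rfl fun j _ => ?_
  simp only [pairRow, arcRow, Pi.add_apply, Pi.smul_apply, Pi.sub_apply, smul_eq_mul]
  push_cast
  ring

/-- In a dissection of a rectangle of width `M`, there is a factor `D` with `0 < D ≤ τ ^ ∑ δᵢ`
such that `M` divides the `D`-fold of all side lengths. -/
lemma exists_multiplier {n : ℕ} {x y : Fin n → ℝ} {a b : Fin n → ℕ} {M : ℕ} {N τ : ℝ}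
    (hτ : 9 / 5 ≤ τ) (hτ3 : τ ^ 2 + τ + 1 ≤ τ ^ 3)
    (ha : ∀ i, 0 < a i) (hb : ∀ i, 0 < b i)
    (hadd : ∀ f g : ℝ → ℝ, ∑ i, (f (x i + a i) - f (x i)) * (g (y i + b i) - g (y i)) =
      (f M - f 0) * (g N - g 0)) :
    ∃ D : ℕ, 0 < D ∧ (D : ℝ) ≤ τ ^ (∑ i, max (a i) (b i) / (a i).gcd (b i)) ∧
      ∀ i, M ∣ D * (a i).gcd (b i) := by
  let p i := a i / (a i).gcd (b i)
  let q i := b i / (a i).gcd (b i)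
  have hgcd i : 0 < (a i).gcd (b i) := Nat.gcd_pos_of_pos_left _ (ha i)
  have hap i : a i = p i * (a i).gcd (b i) := (Nat.div_mul_cancel (Nat.gcd_dvd_left _ _)).symm
  have hbq i : b i = q i * (a i).gcd (b i) := (Nat.div_mul_cancel (Nat.gcd_dvd_right _ _)).symm
  have hp i : 0 < p i := Nat.div_pos (Nat.gcd_le_left _ (ha i)) (hgcd i)
  have hq i : 0 < q i := Nat.div_pos (Nat.gcd_le_right _ (hb i)) (hgcd i)
  have hpq i : (q i : ℝ) * a i = p i * b i := by
    have : q i * a i = p i * b i := by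
      calc q i * a i = q i * (p i * (a i).gcd (b i)) := by rw [← hap]
        _ = p i * (q i * (a i).gcd (b i)) := by ring
        _ = p i * b i := by rw [← hbq]
    exact_mod_cast this
  classical
  let X : Finset ℝ := (Finset.univ.image x ∪ Finset.univ.image fun i => x i + a i) \ {0, (M : ℝ)}
  let Y : Finset ℝ := (Finset.univ.image y ∪ Finset.univ.image fun i => y i + b i) \ {0}
  have hX0 : (0 : ℝ) ∉ X := by simp [X]
  have hXM : (M : ℝ) ∉ X := by simp [X]
  have hY0 : (0 : ℝ) ∉ Y := by simp [Y]
  let t i := toVertex X (x i + a i)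
  let s i := toVertex X (x i)
  let t' i := toVertex Y (y i)
  let s' i := toVertex Y (y i + b i)
  let K : Matrix (Fin n) (X ⊕ Y) ℤ := Matrix.of fun i =>
    (q i : ℤ) • pairRow t s t' s' true i + (p i : ℤ) • pairRow t s t' s' false i
  have hKmul (f g : ℝ → ℝ) (i : Fin n) :
      ∑ j, (K i j : ℝ) * (Sum.elim (fun u : X => f u) (fun u : Y => g u)) j =
      q i * ((if x i + a i ∈ X then f (x i + a i) else 0) - if x i ∈ X then f (x i) else 0) +
      p i * ((if y i ∈ Y then g (y i) else 0) - if y i + b i ∈ Y then g (y i + b i) else 0) := by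
    rw [← toVertex_elim, ← toVertex_elim, ← toVertex_elim, ← toVertex_elim]
    exact sum_weighted_pairRow_mul t s t' s' (q i) (p i) i _
  obtain ⟨e, he, hdet⟩ := exists_injective_det_submatrix_ne_zero K (by
    intro c hc
    let f : ℝ → ℝ := fun z => (toVertex X z).elim 0 (c ∘ Sum.inl)
    let g : ℝ → ℝ := fun z => (toVertex Y z).elim 0 (c ∘ Sum.inr)
    have hfg := eq_zero_of_balanced (f := f) (g := g) ha hb hadd hp hq
      (by simp [f, toVertex, hX0]) (by simp [f, toVertex, hXM]) (by simp [g, toVertex, hY0])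
      fun i => by
        have h := hc i
        simp only [K, Matrix.of_apply] at h
        rw [sum_weighted_pairRow_mul] at h
        simp only [f, g]
        linarith
    have hfX : ∀ u : X, c (Sum.inl u) = f u := fun u => by simp [f, toVertex]
    have hgY : ∀ u : Y, c (Sum.inr u) = g u := fun u => by simp [g, toVertex]
    funext j
    rcases j with ⟨u, hu⟩ | ⟨u, hu⟩
    · rw [hfX]
      simp only [X, Finset.mem_sdiff, Finset.mem_union, Finset.mem_image, Finset.mem_univ,
        true_and] at hu
      rcases hu.1 with ⟨i, rfl⟩ | ⟨i, rfl⟩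
      exacts [(hfg i).1.1, (hfg i).1.2]
    · rw [hgY]
      simp only [Y, Finset.mem_sdiff, Finset.mem_union, Finset.mem_image, Finset.mem_univ,
        true_and] at hu
      rcases hu.1 with ⟨i, rfl⟩ | ⟨i, rfl⟩
      exacts [(hfg i).2.1, (hfg i).2.2])
  set D : ℤ := (K.submatrix e id).det with hD
  have hmemX i (z : ℝ) (hz : z = x i ∨ z = x i + a i) : z ∈ X ↔ z ≠ 0 ∧ z ≠ M := by
    rcases hz with rfl | rfl <;> simp [X]
  have hmemY i (z : ℝ) (hz : z = y i ∨ z = y i + b i) : z ∈ Y ↔ z ≠ 0 := by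
    rcases hz with rfl | rfl <;> simp [Y]
  have hx i (z : ℝ) (hz : z = x i ∨ z = x i + a i) :
      (if z ∈ X then z else 0) = z - M * if z = M then 1 else 0 := by
    simp only [hmemX i z hz]
    by_cases hM : z = M
    · simp [hM]
    · simp only [ne_eq, hM, not_false_eq_true, and_true, if_false, mul_zero, sub_zero]
      by_cases h0 : z = 0 <;> simp [h0]
  have hy i (z : ℝ) (hz : z = y i ∨ z = y i + b i) : (if z ∈ Y then z else 0) = z := by
    simp only [hmemY i z hz]
    by_cases h0 : z = 0 <;> simp [h0]
  have hcoord (j) : ∃ z : ℤ, D * (Sum.elim (fun u : X => (u : ℝ)) (fun u : Y => (u : ℝ))) j =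
      M * z := by
    refine exists_det_mul_eq _ _ _
      (fun j => q (e j) * ((if x (e j) = M then 1 else 0) - if x (e j) + a (e j) = M then 1 else 0))
      (fun j => ?_) j
    have h := hKmul id id (e j)
    simp only [id, hx (e j) _ (Or.inl rfl), hx (e j) _ (Or.inr rfl), hy (e j) _ (Or.inl rfl),
      hy (e j) _ (Or.inr rfl)] at h
    push_cast
    simp only [Matrix.submatrix_apply, id]
    exact h.trans (by linear_combination hpq (e j))
  have hX i (z : ℝ) (hz : z = x i ∨ z = x i + a i) : ∃ k : ℤ, D * z = M * k := by
    by_cases h : z ∈ X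
    · exact hcoord (Sum.inl ⟨z, h⟩)
    · rw [hmemX i z hz, not_and_or, not_not, not_not] at h
      rcases h with rfl | rfl
      exacts [⟨0, by simp⟩, ⟨D, mul_comm _ _⟩]
  have hY i (z : ℝ) (hz : z = y i ∨ z = y i + b i) : ∃ k : ℤ, D * z = M * k := by
    by_cases h : z ∈ Y
    · exact hcoord (Sum.inr ⟨z, h⟩)
    · rw [hmemY i z hz, not_not] at h
      exact ⟨0, by simp [h]⟩
  refine ⟨D.natAbs, Int.natAbs_pos.mpr hdet, ?_, fun i => ?_⟩
  · have h := abs_det_pairRow_le (fun j => t (e j)) (fun j => s (e j)) (fun j => t' (e j))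
      (fun j => s' (e j)) (fun c j => if c then q (e j) else p (e j)) hτ hτ3
      (by
        rintro (_ | _) j
        exacts [hp _, hq _])
      (fun j => (Nat.coprime_div_gcd_div_gcd (hgcd _)).symm)
    have hmax i : max (q i) (p i) = max (a i) (b i) / (a i).gcd (b i) := by
      rw [max_comm]
      exact (Monotone.map_max fun _ _ h => Nat.div_le_div_right h).symm
    simp only [if_true, Bool.false_eq_true, if_false, hmax, Finset.prod_pow_eq_pow_sum] at h
    rw [Nat.cast_natAbs, Int.cast_abs]
    refine h.trans (pow_le_pow_right₀ (by linarith) ?_)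
    rw [← Finset.sum_image (s := Finset.univ) (g := e)
      (f := fun i => max (a i) (b i) / (a i).gcd (b i)) he.injOn]
    exact Finset.sum_le_sum_of_subset (Finset.subset_univ _)
  · obtain ⟨k, hk⟩ := hX i _ (Or.inl rfl)
    obtain ⟨k', hk'⟩ := hX i _ (Or.inr rfl)
    obtain ⟨l, hl⟩ := hY i _ (Or.inl rfl)
    obtain ⟨l', hl'⟩ := hY i _ (Or.inr rfl)
    have h1 : (M : ℤ) ∣ D * a i := ⟨k' - k, by
      have : (D * a i : ℝ) = M * (k' - k) := by linear_combination hk' - hk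
      exact_mod_cast this⟩
    have h2 : (M : ℤ) ∣ D * b i := ⟨l' - l, by
      have : (D * b i : ℝ) = M * (l' - l) := by linear_combination hl' - hl
      exact_mod_cast this⟩
    rw [← Nat.gcd_mul_left]
    refine Nat.dvd_gcd ?_ ?_
    · simpa [Int.natAbs_mul] using Int.natAbs_dvd_natAbs.mpr h1
    · simpa [Int.natAbs_mul] using Int.natAbs_dvd_natAbs.mpr h2

lemma le_pow_mul_gcd {n : ℕ} {x y : Fin n → ℝ} {a b : Fin n → ℕ} {M : ℕ} {N τ : ℝ}
    (hτ : 9 / 5 ≤ τ) (hτ3 : τ ^ 2 + τ + 1 ≤ τ ^ 3)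
    (ha : ∀ i, 0 < a i) (hb : ∀ i, 0 < b i)
    (hadd : ∀ f g : ℝ → ℝ, ∑ i, (f (x i + a i) - f (x i)) * (g (y i + b i) - g (y i)) =
      (f M - f 0) * (g N - g 0)) (hd : 0 < Finset.univ.gcd fun i => (a i).gcd (b i)) :
    (M : ℝ) ≤ τ ^ (∑ i, max (a i) (b i) / (a i).gcd (b i)) *
      (Finset.univ.gcd fun i => (a i).gcd (b i) : ℕ) := by
  obtain ⟨D, hD, hDτ, hdvd⟩ := exists_multiplier hτ hτ3 ha hb hadd
  have h : M ∣ D * Finset.univ.gcd fun i => (a i).gcd (b i) := by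
    rw [← normalize_eq D, ← Finset.gcd_mul_left]
    exact Finset.dvd_gcd fun i _ => hdvd i
  calc (M : ℝ) ≤ (D * Finset.univ.gcd fun i => (a i).gcd (b i) : ℕ) :=
        Nat.cast_le.mpr (Nat.le_of_dvd (Nat.mul_pos hD hd) h)
    _ = D * (Finset.univ.gcd fun i => (a i).gcd (b i) : ℕ) := Nat.cast_mul _ _
    _ ≤ _ := mul_le_mul_of_nonneg_right hDτ (Nat.cast_nonneg _)

end RectDissection

/-- **Sum of biases in a rectangular dissection.**
If the rectangle `R = [0,M] × [0,N]` is dissected into `n` axis-parallel rectangular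
tiles with positive integer side lengths `a i × b i`, `d` is the gcd of all the
`gcd (a i) (b i)`, and `δ i = max (a i) (b i) / gcd (a i) (b i)` is the arithmetic
bias of the `i`-th tile, then `τ ^ (δ 1 + ⋯ + δ n) ≥ max M N / d`, where `τ > 1` is
the real root of `x³ = x² + 3`. -/
theorem sum_of_biases (τ : ℝ) (hτ1 : 1 < τ) (hτ : τ ^ 3 = τ ^ 2 + 3)
    (M N : ℕ) (hM : 0 < M) (hN : 0 < N) (n : ℕ)
    (x y : Fin n → ℝ) (a b : Fin n → ℕ)
    (ha : ∀ i, 0 < a i) (hb : ∀ i, 0 < b i)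
    (hsub : ∀ i, rectTile (x i) (y i) (a i) (b i) ⊆
      Set.Icc (0 : ℝ) M ×ˢ Set.Icc (0 : ℝ) N)
    (hdisj : Pairwise fun i j =>
      Disjoint (interior (rectTile (x i) (y i) (a i) (b i)))
        (interior (rectTile (x j) (y j) (a j) (b j))))
    (hcover : (⋃ i, rectTile (x i) (y i) (a i) (b i)) =
      Set.Icc (0 : ℝ) M ×ˢ Set.Icc (0 : ℝ) N) :
    τ ^ (∑ i, (max (a i) (b i) : ℝ) / (Nat.gcd (a i) (b i) : ℝ)) ≥
      (max M N : ℝ) / ((Finset.univ.gcd fun i => Nat.gcd (a i) (b i) : ℕ) : ℝ) := by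
  have hτ2 : τ ≤ 2 := by nlinarith [sq_nonneg τ]
  have hτ95 : 9 / 5 ≤ τ := by nlinarith [sq_nonneg τ]
  have hτ3 : τ ^ 2 + τ + 1 ≤ τ ^ 3 := by linarith
  have hadd := RectDissection.sum_increment_mul_increment hdisj hcover
  have hexp : ∑ i, (max (a i) (b i) : ℝ) / (Nat.gcd (a i) (b i) : ℝ) =
      (∑ i, max (a i) (b i) / (a i).gcd (b i) : ℕ) := by
    rw [Nat.cast_sum]
    refine Finset.sum_congr rfl fun i _ => ?_
    have hdvd : (a i).gcd (b i) ∣ max (a i) (b i) := by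
      rcases max_choice (a i) (b i) with h | h <;> rw [h]
      exacts [Nat.gcd_dvd_left _ _, Nat.gcd_dvd_right _ _]
    rw [Nat.cast_div hdvd (Nat.cast_ne_zero.mpr (Nat.gcd_pos_of_pos_left _ (ha i)).ne'),
      Nat.cast_max]
  rw [hexp, Real.rpow_natCast, ge_iff_le]
  rcases Nat.eq_zero_or_pos (Finset.univ.gcd fun i => Nat.gcd (a i) (b i)) with hd | hd
  · rw [hd, Nat.cast_zero, div_zero]
    positivity
  rw [div_le_iff₀ (Nat.cast_pos.mpr hd)]
  refine max_le (RectDissection.le_pow_mul_gcd hτ95 hτ3 ha hb hadd hd) ?_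
  have h := RectDissection.le_pow_mul_gcd (x := y) (y := x) (M := N) (N := M) hτ95 hτ3 hb ha
    (fun f g => by simpa only [mul_comm] using hadd g f)
  simp only [max_comm (b _), Nat.gcd_comm (b _)] at h
  exact h hd
end

section
/- Let M and N be positive integers and suppose the rectangle R = [0,M] × [0,N] ⊆ ℝ² is dissected into n axis-parallel square tiles with positive integer side lengths a_1, …, a_n satisfying gcd(a_1, …, a_n) = 1 (a prime squaring). Then τ^n ≥ max(M,N); equivalently, n ≥ log_τ(max(M,N)). -/
/-- The closed axis-parallel square `[x, x+a] × [y, y+a] ⊆ ℝ²` with lower-left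
corner `(x, y)` and side length `a`. -/
def sqTile (x y : ℝ) (a : ℕ) : Set (ℝ × ℝ) :=
  Set.Icc x (x + a) ×ˢ Set.Icc y (y + a)

/-- Two directed multigraphs on the edge set `A`, with edges `s i → t i` and `l i → r i`, are
algebraically dual if the potential differences of the second one are exactly the vectors
orthogonal to the potential differences of the first one. -/
structure GraphDual {E V F : Type*} (A : Finset E) (s t : E → V) (l r : E → F) : Prop where
  orth : ∀ (f : V → ℝ) (g : F → ℝ),
    ∑ i ∈ A, (f (t i) - f (s i)) * (g (r i) - g (l i)) = 0
  complete : ∀ z : E → ℝ, (∀ f : V → ℝ, ∑ i ∈ A, z i * (f (t i) - f (s i)) = 0) →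
    ∃ g : F → ℝ, ∀ i ∈ A, z i = g (r i) - g (l i)

/-- `S` is a basis of the graphic matroid of the first graph and `A \ S` is one of the second. -/
def IsGraphBase {E V F : Type*} (A : Finset E) (s t : E → V) (l r : E → F) (S : Finset E) :
    Prop :=
  S ⊆ A ∧
  (∀ f : V → ℝ, (∀ i ∈ S, f (t i) = f (s i)) → ∀ i ∈ A, f (t i) = f (s i)) ∧
  (∀ g : F → ℝ, (∀ i ∈ A, i ∉ S → g (r i) = g (l i)) → ∀ i ∈ A, g (r i) = g (l i))

open Classical in
/-- The set of bases of a pair of dual graphs. -/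
noncomputable def graphBases {E V F : Type*} (A : Finset E) (s t : E → V) (l r : E → F) :
    Finset (Finset E) :=
  A.powerset.filter (IsGraphBase A s t l r)

theorem mem_graphBases {E V F : Type*} {A : Finset E} {s t : E → V} {l r : E → F}
    {S : Finset E} : S ∈ graphBases A s t l r ↔ IsGraphBase A s t l r S := by
  classical
  simp only [graphBases, Finset.mem_filter, Finset.mem_powerset, and_iff_right_iff_imp]
  exact fun h => h.1

namespace GraphDual

variable {E V F : Type*} {A : Finset E} {s t : E → V} {l r : E → F}

/-- The potential-difference map of a graph, with values in Euclidean space. -/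
noncomputable def diff (A : Finset E) (s t : E → V) : (V → ℝ) →ₗ[ℝ] EuclideanSpace ℝ A where
  toFun f := WithLp.toLp 2 fun i => f (t i) - f (s i)
  map_add' f g := by ext i; simp; ring
  map_smul' c f := by ext i; simp; ring

theorem inner_diff (f : V → ℝ) (z : EuclideanSpace ℝ A) :
    inner ℝ (diff A s t f) z = ∑ i : A, z i * (f (t i) - f (s i)) := by
  simp [PiLp.inner_apply, diff]

theorem exists_of_mem_orthogonal (h : GraphDual A s t l r) {z : EuclideanSpace ℝ A}
    (hz : z ∈ (LinearMap.range (diff A s t))ᗮ) : ∃ g : F → ℝ, z = diff A l r g := by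
  classical
  obtain ⟨g, hg⟩ := h.complete (fun i => if hi : i ∈ A then z ⟨i, hi⟩ else 0) (by
    intro f
    have := (Submodule.mem_orthogonal _ _).1 hz _ ⟨f, rfl⟩
    rw [inner_diff] at this
    rw [← this, ← Finset.sum_coe_sort]
    simp)
  refine ⟨g, ?_⟩
  ext i
  have := hg i i.2
  simpa [diff] using this

theorem symm (h : GraphDual A s t l r) : GraphDual A l r s t where
  orth f g := by
    rw [← h.orth g f]
    exact Finset.sum_congr rfl fun i _ => mul_comm _ _
  complete z hz := by
    have hmem : WithLp.toLp 2 (fun i : A => z i) ∈ (LinearMap.range (diff A s t))ᗮᗮ := by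
      rw [Submodule.mem_orthogonal]
      intro w hw
      obtain ⟨g, rfl⟩ := h.exists_of_mem_orthogonal hw
      rw [inner_diff, ← hz g, ← Finset.sum_coe_sort A]
    rw [Submodule.orthogonal_orthogonal] at hmem
    obtain ⟨f, hf⟩ := hmem
    refine ⟨f, fun i hi => ?_⟩
    have := congrArg (fun w : EuclideanSpace ℝ A => w ⟨i, hi⟩) hf
    simpa [diff] using this.symm

theorem _root_.IsGraphBase.symm [DecidableEq E] {S : Finset E} (h : IsGraphBase A s t l r S) :
    IsGraphBase A l r s t (A \ S) := by
  refine ⟨Finset.sdiff_subset, fun g hg => h.2.2 g fun i hi hS => hg i (by simp [hi, hS]),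
    fun f hf => h.2.1 f fun i hi => hf i (h.1 hi) (by simp [hi])⟩

theorem _root_.card_graphBases_symm_le (A : Finset E) (s t : E → V) (l r : E → F) :
    (graphBases A s t l r).card ≤ (graphBases A l r s t).card := by
  classical
  refine Finset.card_le_card_of_injOn (fun S => A \ S)
    (fun S hS => mem_graphBases.2 (mem_graphBases.1 hS).symm) fun S hS T hT hST => ?_
  have h1 := (mem_graphBases.1 hS).1
  have h2 := (mem_graphBases.1 hT).1
  rw [← Finset.sdiff_sdiff_eq_self h1, ← Finset.sdiff_sdiff_eq_self h2]
  exact congrArg (fun X => A \ X) hST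

/-- Deleting an edge of a graph contracts it in the dual. -/
theorem exists_delete [DecidableEq E] (h : GraphDual A s t l r) {e : E} (he : e ∈ A) :
    ∃ l' r' : E → F, GraphDual (A.erase e) s t l' r' ∧
      ∀ S, IsGraphBase A s t l r S → e ∉ S → IsGraphBase (A.erase e) s t l' r' S := by
  classical
  set φ : F → F := fun x => if x = l e then r e else x with hφ
  have hφe : φ (r e) = φ (l e) := by simp [hφ]
  refine ⟨φ ∘ l, φ ∘ r, ⟨fun f g => ?_, fun z hz => ?_⟩, fun S hS heS => ⟨?_, ?_, ?_⟩⟩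
  · have := h.orth f (g ∘ φ)
    rw [← Finset.add_sum_erase _ _ he] at this
    simpa [hφe] using this
  · obtain ⟨g, hg⟩ := h.complete (fun i => if i = e then 0 else z i) (fun f => by
      rw [← Finset.add_sum_erase _ _ he, if_pos rfl, zero_mul, zero_add]
      refine (Finset.sum_congr rfl fun i hi => ?_).trans (hz f)
      rw [if_neg (Finset.ne_of_mem_erase hi)])
    have hge : g (r e) = g (l e) := by
      have := hg e he
      simp only [if_true] at this
      linarith
    have hgφ : ∀ x, g (φ x) = g x := by
      intro x
      by_cases hx : x = l e
      · simp [hφ, hx, hge]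
      · simp [hφ, hx]
    refine ⟨g, fun i hi => ?_⟩
    have := hg i (Finset.mem_of_mem_erase hi)
    rw [if_neg (Finset.ne_of_mem_erase hi)] at this
    simp [hgφ, this]
  · exact Finset.subset_erase.2 ⟨hS.1, heS⟩
  · exact fun f hf i hi => hS.2.1 f hf i (Finset.mem_of_mem_erase hi)
  · intro g hg i hi
    refine hS.2.2 (g ∘ φ) (fun j hj hjS => ?_) i (Finset.mem_of_mem_erase hi)
    by_cases hje : j = e
    · subst hje
      simp [hφe]
    · exact hg j (Finset.mem_erase.2 ⟨hje, hj⟩) hjS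

/-- Contracting an edge of a graph deletes it in the dual. -/
theorem exists_contract [DecidableEq E] (h : GraphDual A s t l r) {e : E} (he : e ∈ A) :
    ∃ s' t' : E → V, GraphDual (A.erase e) s' t' l r ∧
      ∀ S, IsGraphBase A s t l r S → e ∈ S →
        IsGraphBase (A.erase e) s' t' l r (S.erase e) := by
  obtain ⟨s', t', hD, hB⟩ := h.symm.exists_delete he
  refine ⟨s', t', hD.symm, fun S hS heS => ?_⟩
  have := (hB _ hS.symm (by simp [heS])).symm
  convert this using 1
  ext i
  have := @hS.1 i
  simp only [Finset.mem_erase, Finset.mem_sdiff]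
  tauto

theorem exists_minor [DecidableEq E] (h : GraphDual A s t l r) (X : Finset E) {K : Finset E}
    (hK : K ⊆ A) :
    ∃ (s' t' : E → V) (l' r' : E → F), GraphDual (A \ K) s' t' l' r' ∧
      ∀ S, IsGraphBase A s t l r S → S ∩ K = X ∩ K →
        IsGraphBase (A \ K) s' t' l' r' (S \ K) := by
  induction K using Finset.induction_on with
  | empty => exact ⟨s, t, l, r, by simpa using h, fun S hS _ => by simpa using hS⟩
  | insert e K heK ih =>
    obtain ⟨s', t', l', r', hD, hB⟩ := ih ((Finset.subset_insert _ _).trans hK)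
    have he : e ∈ A \ K := by
      simp [heK, hK (Finset.mem_insert_self e K)]
    have hAe : (A \ K).erase e = A \ insert e K := by
      ext i; simp only [Finset.mem_erase, Finset.mem_sdiff, Finset.mem_insert]; tauto
    have key : ∀ S, S ∩ insert e K = X ∩ insert e K → S ∩ K = X ∩ K ∧ (e ∈ S ↔ e ∈ X) := by
      intro S hS
      constructor
      · ext i
        have := Finset.ext_iff.1 hS i
        simp only [Finset.mem_inter, Finset.mem_insert] at this ⊢
        tauto
      · have := Finset.ext_iff.1 hS e
        simpa using this
    by_cases heX : e ∈ X
    · obtain ⟨s'', t'', hD', hB'⟩ := hD.exists_contract he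
      rw [hAe] at hD' hB'
      refine ⟨s'', t'', l', r', hD', fun S hS hSX => ?_⟩
      have := hB' _ (hB S hS (key S hSX).1) (by simp [heK, (key S hSX).2.2 heX])
      convert this using 1
      ext i; simp only [Finset.mem_erase, Finset.mem_sdiff, Finset.mem_insert]; tauto
    · obtain ⟨l'', r'', hD', hB'⟩ := hD.exists_delete he
      rw [hAe] at hD' hB'
      refine ⟨s', t', l'', r'', hD', fun S hS hSX => ?_⟩
      have heS : e ∉ S := fun h' => heX ((key S hSX).2.1 h')
      have := hB' _ (hB S hS (key S hSX).1) (by simp [heS])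
      convert this using 1
      ext i
      simp only [Finset.mem_sdiff, Finset.mem_insert]
      constructor
      · tauto
      · rintro ⟨h1, h2⟩
        exact ⟨h1, by rintro (rfl | h3) <;> tauto⟩

/-- If every nonempty cut has at least four edges, then at most half as many vertices as there are
edges are incident to an edge that is not a loop. -/
theorem exists_small_vertexSet [DecidableEq E] (A : Finset E) (s t : E → V)
    (h : ∀ f : V → ℝ, (∃ i ∈ A, f (t i) ≠ f (s i)) →
      4 ≤ (A.filter fun i => f (t i) ≠ f (s i)).card) :
    ∃ W : Finset V, 2 * W.card ≤ A.card ∧ ∀ i ∈ A, t i ≠ s i → t i ∈ W ∧ s i ∈ W := by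
  classical
  have hf : ∀ v i, (Pi.single v 1 : V → ℝ) (t i) ≠ (Pi.single v 1 : V → ℝ) (s i) ↔
      ((t i = v ∧ s i ≠ v) ∨ (t i ≠ v ∧ s i = v)) := by
    intro v i
    by_cases h1 : t i = v <;> by_cases h2 : s i = v <;> simp [h1, h2]
  refine ⟨((A.image s) ∪ (A.image t)).filter
    fun v => ∃ i ∈ A, ((t i = v ∧ s i ≠ v) ∨ (t i ≠ v ∧ s i = v)), ?_, ?_⟩
  · have h4 := Finset.card_nsmul_le_sum (((A.image s) ∪ (A.image t)).filter
      fun v => ∃ i ∈ A, ((t i = v ∧ s i ≠ v) ∨ (t i ≠ v ∧ s i = v)))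
      (fun v => (A.filter fun i => ((t i = v ∧ s i ≠ v) ∨ (t i ≠ v ∧ s i = v))).card) 4 (by
        intro v hv
        have := h (Pi.single v 1)
        simp only [hf] at this
        exact this (Finset.mem_filter.1 hv).2)
    have h5 := Finset.sum_card_bipartiteAbove_eq_sum_card_bipartiteBelow
      (s := (((A.image s) ∪ (A.image t)).filter
      fun v => ∃ i ∈ A, ((t i = v ∧ s i ≠ v) ∨ (t i ≠ v ∧ s i = v)))) (t := A)
      (fun v i => ((t i = v ∧ s i ≠ v) ∨ (t i ≠ v ∧ s i = v)))
    have h6 := Finset.sum_le_card_nsmul A (fun i => (Finset.bipartiteBelow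
      (fun v i => ((t i = v ∧ s i ≠ v) ∨ (t i ≠ v ∧ s i = v)))
      (((A.image s) ∪ (A.image t)).filter
      fun v => ∃ i ∈ A, ((t i = v ∧ s i ≠ v) ∨ (t i ≠ v ∧ s i = v))) i).card) 2 (by
        intro i _
        refine (Finset.card_le_card (t := {t i, s i}) fun v hv => ?_).trans Finset.card_le_two
        have := (Finset.mem_bipartiteBelow _).1 hv
        simp only [Finset.mem_insert, Finset.mem_singleton]
        tauto)
    simp only [Finset.bipartiteAbove, smul_eq_mul] at h4 h5 h6
    omega
  · intro i hi hne
    refine ⟨Finset.mem_filter.2 ⟨?_, i, hi, Or.inl ⟨rfl, hne.symm⟩⟩,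
      Finset.mem_filter.2 ⟨?_, i, hi, Or.inr ⟨hne, rfl⟩⟩⟩
    · exact Finset.mem_union_right _ (Finset.mem_image_of_mem _ hi)
    · exact Finset.mem_union_left _ (Finset.mem_image_of_mem _ hi)

theorem exists_eq_diff (W : Finset V) (hW : ∀ i ∈ A, t i ≠ s i → t i ∈ W ∧ s i ∈ W) :
    ∃ Φ : (W → ℝ) →ₗ[ℝ] EuclideanSpace ℝ A,
      (∀ f, diff A s t f = Φ fun v => f v) ∧ Φ (fun _ => 1) = 0 := by
  classical
  let ext : (W → ℝ) →ₗ[ℝ] (V → ℝ) :=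
    { toFun := fun f v => if h : v ∈ W then f ⟨v, h⟩ else 0
      map_add' := fun f g => by ext v; by_cases h : v ∈ W <;> simp [h]
      map_smul' := fun c f => by ext v; by_cases h : v ∈ W <;> simp [h] }
  refine ⟨(diff A s t).comp ext, fun f => ?_, ?_⟩
  · ext i
    by_cases h : t i = s i
    · simp [diff, h]
    · have := hW i i.2 h
      simp [diff, ext, this.1, this.2]
  · ext i
    by_cases h : t i = s i
    · simp [diff, h]
    · have := hW i i.2 h
      simp [diff, ext, this.1, this.2]

/-- One of two dual graphs has a nonempty cut with at most three edges. -/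
theorem exists_small_cut (h : GraphDual A s t l r) (hA : A.Nonempty) :
    (∃ f : V → ℝ, (∃ i ∈ A, f (t i) ≠ f (s i)) ∧
      (A.filter fun i => f (t i) ≠ f (s i)).card ≤ 3) ∨
    (∃ g : F → ℝ, (∃ i ∈ A, g (r i) ≠ g (l i)) ∧
      (A.filter fun i => g (r i) ≠ g (l i)).card ≤ 3) := by
  classical
  by_contra! hcon
  obtain ⟨W, hWc, hW⟩ := exists_small_vertexSet A s t fun f hf => hcon.1 f hf
  obtain ⟨W', hWc', hW'⟩ := exists_small_vertexSet A l r fun f hf => hcon.2 f hf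
  obtain ⟨Φ, hΦ, hΦ1⟩ := exists_eq_diff W hW
  obtain ⟨Ψ, hΨ, hΨ1⟩ := exists_eq_diff W' hW'
  set Θ := Φ.coprod Ψ with hΘ
  have hsurj : LinearMap.range Θ = ⊤ := by
    rw [← Submodule.orthogonal_eq_bot_iff, Submodule.eq_bot_iff]
    intro z hz
    rw [Submodule.mem_orthogonal] at hz
    obtain ⟨g, hg⟩ := h.exists_of_mem_orthogonal (z := z) (by
      rw [Submodule.mem_orthogonal]
      rintro _ ⟨f, rfl⟩
      exact hz _ ⟨(fun v => f v, 0), by simp [hΘ, hΦ]⟩)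
    have := hz z ⟨(0, fun v => g v), by simp [hΘ, hg, hΨ]⟩
    exact inner_self_eq_zero.1 this
  have hdim : Module.finrank ℝ ((W → ℝ) × (W' → ℝ)) = W.card + W'.card := by
    simp
  have hdim' : Module.finrank ℝ (EuclideanSpace ℝ A) = A.card := by simp
  have hle := LinearMap.finrank_le_finrank_of_surjective (LinearMap.range_eq_top.1 hsurj)
  have heq : Module.finrank ℝ ((W → ℝ) × (W' → ℝ)) = Module.finrank ℝ (EuclideanSpace ℝ A) := by
    refine le_antisymm ?_ hle
    rw [hdim, hdim']
    omega
  have hinj := (LinearMap.injective_iff_surjective_of_finrank_eq_finrank heq).2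
    (LinearMap.range_eq_top.1 hsurj)
  have hpos := hA.card_pos
  have h1 : Θ ((fun _ => 1), (fun _ => 1)) = Θ 0 := by simp [hΘ, hΦ1, hΨ1]
  have h2 := hinj h1
  rw [Prod.ext_iff] at h2
  rcases W.eq_empty_or_nonempty with hWe | ⟨v, hv⟩
  · rcases W'.eq_empty_or_nonempty with hWe' | ⟨v, hv⟩
    · have h3 := Finset.card_eq_zero.2 hWe
      have h4 := Finset.card_eq_zero.2 hWe'
      omega
    · simpa using congrFun h2.2 ⟨v, hv⟩
  · simpa using congrFun h2.1 ⟨v, hv⟩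

variable {τ : ℝ}

theorem card_filter_inter_le [DecidableEq E] (h : GraphDual A s t l r)
    (ih : ∀ A' : Finset E, A'.card < A.card → ∀ (s t : E → V) (l r : E → F),
      GraphDual A' s t l r → ((graphBases A' s t l r).card : ℝ) ≤ τ ^ A'.card)
    {K : Finset E} (hK : K ⊆ A) (hK0 : K.Nonempty) (X : Finset E) :
    (((graphBases A s t l r).filter fun S => S ∩ K = X).card : ℝ) ≤ τ ^ (A.card - K.card) := by
  obtain ⟨s', t', l', r', hD, hB⟩ := h.exists_minor X hK
  have hc : (A \ K).card = A.card - K.card := Finset.card_sdiff_of_subset hK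
  have := hK0.card_pos
  have := Finset.card_le_card hK
  have h1 := ih (A \ K) (by omega) _ _ _ _ hD
  rw [hc] at h1
  refine le_trans ?_ h1
  norm_cast
  refine Finset.card_le_card_of_injOn (fun S => S \ K) (fun S hS => ?_) fun S hS T hT hST => ?_
  · obtain ⟨hS1, hS2⟩ := Finset.mem_filter.1 hS
    refine mem_graphBases.2 (hB S (mem_graphBases.1 hS1) ?_)
    rw [← hS2, Finset.inter_assoc, Finset.inter_self]
  · have hS2 := (Finset.mem_filter.1 hS).2
    have hT2 := (Finset.mem_filter.1 hT).2
    rw [← Finset.sdiff_union_inter S K, ← Finset.sdiff_union_inter T K, hS2, hT2]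
    exact congrArg (· ∪ X) hST

theorem card_graphBases_le_of_small_cut (hτ1 : 1 < τ) (hτ : τ ^ 3 = τ ^ 2 + 3)
    (h : GraphDual A s t l r)
    (ih : ∀ A' : Finset E, A'.card < A.card → ∀ (s t : E → V) (l r : E → F),
      GraphDual A' s t l r → ((graphBases A' s t l r).card : ℝ) ≤ τ ^ A'.card)
    (f : V → ℝ) (hf : ∃ i ∈ A, f (t i) ≠ f (s i))
    (hf3 : (A.filter fun i => f (t i) ≠ f (s i)).card ≤ 3) :
    ((graphBases A s t l r).card : ℝ) ≤ τ ^ A.card := by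
  classical
  set K := A.filter fun i => f (t i) ≠ f (s i) with hKdef
  have hKA : K ⊆ A := Finset.filter_subset _ _
  have hKne : K.Nonempty := let ⟨i, hi, hne⟩ := hf; ⟨i, Finset.mem_filter.2 ⟨hi, hne⟩⟩
  have hmeet : ∀ S ∈ graphBases A s t l r, ∃ i ∈ K, i ∈ S := by
    intro S hS
    by_contra! hno
    obtain ⟨i, hi, hne⟩ := hf
    refine hne ((mem_graphBases.1 hS).2.1 f (fun j hj => ?_) i hi)
    by_contra hj'
    exact hno j (Finset.mem_filter.2 ⟨(mem_graphBases.1 hS).1 hj, hj'⟩) hj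
  have hcount : ∀ K' ⊆ K, K'.Nonempty → ∀ X,
      (((graphBases A s t l r).filter fun S => S ∩ K' = X).card : ℝ) ≤
        τ ^ (A.card - K'.card) :=
    fun K' hK' hne X => h.card_filter_inter_le ih (hK'.trans hKA) hne X
  have hcard := Finset.card_le_card hKA
  have hτ0 : (0 : ℝ) < τ := by linarith
  have hK1 := hKne.card_pos
  obtain hc | hc | hc : K.card = 1 ∨ K.card = 2 ∨ K.card = 3 := by omega
  · obtain ⟨a, ha⟩ := Finset.card_eq_one.1 hc
    have hsub : graphBases A s t l r ⊆
        (graphBases A s t l r).filter fun S => S ∩ {a} = {a} := by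
      intro S hS
      obtain ⟨i, hiK, hiS⟩ := hmeet S hS
      rw [ha, Finset.mem_singleton] at hiK
      subst hiK
      exact Finset.mem_filter.2 ⟨hS, by simpa using hiS⟩
    have h1 := hcount {a} (by simp [ha]) (by simp) {a}
    have h2 := Nat.cast_le (α := ℝ).2 (Finset.card_le_card hsub)
    exact h2.trans (h1.trans (pow_le_pow_right₀ hτ1.le (Nat.sub_le _ _)))
  · obtain ⟨a, b, hab, hK⟩ := Finset.card_eq_two.1 hc
    have hsub : graphBases A s t l r ⊆
        ((graphBases A s t l r).filter fun S => S ∩ {a} = {a}) ∪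
        (graphBases A s t l r).filter fun S => S ∩ K = {b} := by
      intro S hS
      obtain ⟨i, hiK, hiS⟩ := hmeet S hS
      rw [hK] at hiK
      simp only [Finset.mem_insert, Finset.mem_singleton] at hiK
      by_cases haS : a ∈ S
      · exact Finset.mem_union_left _ (Finset.mem_filter.2 ⟨hS, by simpa using haS⟩)
      · have hbS : b ∈ S := by rcases hiK with rfl | rfl <;> tauto
        refine Finset.mem_union_right _ (Finset.mem_filter.2 ⟨hS, ?_⟩)
        rw [hK]
        ext j
        simp only [Finset.mem_inter, Finset.mem_insert, Finset.mem_singleton]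
        constructor
        · rintro ⟨h1, rfl | rfl⟩ <;> tauto
        · rintro rfl; tauto
    have h1 := hcount {a} (by simp [hK]) (by simp) {a}
    have h2 := hcount K subset_rfl hKne {b}
    have h3 := Nat.cast_le (α := ℝ).2
      ((Finset.card_le_card hsub).trans (Finset.card_union_le _ _))
    obtain ⟨m, hm⟩ : ∃ m, A.card = m + 2 := ⟨A.card - 2, by omega⟩
    rw [Finset.card_singleton, hm] at h1
    rw [hc, hm] at h2
    simp only [Nat.add_sub_cancel, show m + 2 - 1 = m + 1 by omega] at h1 h2
    have hτ2 : τ + 1 ≤ τ ^ 2 := by nlinarith [sq_nonneg (τ - 1)]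
    have := mul_le_mul_of_nonneg_left hτ2 (pow_pos hτ0 m).le
    push_cast at h3
    calc _ ≤ τ ^ (m + 1) + τ ^ m := by linarith
      _ = τ ^ m * (τ + 1) := by ring
      _ ≤ τ ^ m * τ ^ 2 := this
      _ = τ ^ A.card := by rw [hm]; ring
  · obtain ⟨a, b, c, hab, hac, hbc, hK⟩ := Finset.card_eq_three.1 hc
    have hsub : graphBases A s t l r ⊆
        (((graphBases A s t l r).filter fun S => S ∩ {a} = {a}) ∪
        (graphBases A s t l r).filter fun S => S ∩ K = {b}) ∪
        (((graphBases A s t l r).filter fun S => S ∩ K = {c}) ∪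
        (graphBases A s t l r).filter fun S => S ∩ K = {b, c}) := by
      intro S hS
      obtain ⟨i, hiK, hiS⟩ := hmeet S hS
      rw [hK] at hiK
      simp only [Finset.mem_insert, Finset.mem_singleton] at hiK
      simp only [Finset.mem_union, Finset.mem_filter, hS, true_and]
      by_cases haS : a ∈ S
      · simp [haS]
      · have hSK : S ∩ K = ({b, c} : Finset E).filter (· ∈ S) := by
          rw [hK]
          ext j
          simp only [Finset.mem_inter, Finset.mem_insert, Finset.mem_singleton, Finset.mem_filter]
          constructor
          · rintro ⟨h1, rfl | rfl | rfl⟩ <;> tauto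
          · tauto
        rw [hSK]
        by_cases hbS : b ∈ S <;> by_cases hcS : c ∈ S
        · simp [Finset.filter_insert, Finset.filter_singleton, hbS, hcS]
        · simp [Finset.filter_insert, Finset.filter_singleton, hbS, hcS]
        · simp [Finset.filter_insert, Finset.filter_singleton, hbS, hcS]
        · rcases hiK with rfl | rfl | rfl <;> tauto
    have h1 := hcount {a} (by simp [hK]) (by simp) {a}
    have h2 := hcount K subset_rfl hKne
    have h3 := Nat.cast_le (α := ℝ).2 ((Finset.card_le_card hsub).trans
      ((Finset.card_union_le _ _).trans
        (add_le_add (Finset.card_union_le _ _) (Finset.card_union_le _ _))))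
    obtain ⟨m, hm⟩ : ∃ m, A.card = m + 3 := ⟨A.card - 3, by omega⟩
    rw [Finset.card_singleton, hm] at h1
    rw [hc, hm] at h2
    simp only [Nat.add_sub_cancel, show m + 3 - 1 = m + 2 by omega] at h1 h2
    push_cast at h3
    calc _ ≤ τ ^ (m + 2) + 3 * τ ^ m := by linarith [h2 {b}, h2 {c}, h2 {b, c}]
      _ = τ ^ m * (τ ^ 2 + 3) := by ring
      _ = τ ^ A.card := by rw [hm, ← hτ]; ring

/-- A pair of dual graphs with `n` edges has at most `τ ^ n` bases. -/
theorem card_graphBases_le (hτ1 : 1 < τ) (hτ : τ ^ 3 = τ ^ 2 + 3) (h : GraphDual A s t l r) :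
    ((graphBases A s t l r).card : ℝ) ≤ τ ^ A.card := by
  induction hn : A.card using Nat.strong_induction_on generalizing A s t l r with
  | _ n ih =>
  subst hn
  rcases A.eq_empty_or_nonempty with rfl | hA
  · have : graphBases (∅ : Finset E) s t l r ⊆ {∅} := by
      intro S hS
      simpa using (mem_graphBases.1 hS).1
    have := Finset.card_le_card this
    simpa using this
  · rcases h.exists_small_cut hA with ⟨f, hf, hf3⟩ | ⟨g, hg, hg3⟩
    · exact card_graphBases_le_of_small_cut hτ1 hτ h
        (fun A' hA' s t l r h' => ih _ hA' h' rfl) f hf hf3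
    · refine le_trans (by exact_mod_cast card_graphBases_symm_le A s t l r)
        (card_graphBases_le_of_small_cut hτ1 hτ h.symm
        (fun A' hA' s t l r h' => ?_) g hg hg3)
      exact le_trans (by exact_mod_cast card_graphBases_symm_le A' s t l r)
        (ih _ hA' h'.symm rfl)

end GraphDual

/-- The incidence matrix of a directed multigraph, with rows selected by `ρ`. -/
def graphMatrix {E V W : Type*} [DecidableEq V] (R : Type*) [Ring R] (s t : E → V) (ρ : W → V) :
    Matrix W E R :=
  Matrix.of fun w i => (if t i = ρ w then 1 else 0) - (if s i = ρ w then 1 else 0)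

section Incidence

variable {E V W : Type*} [DecidableEq V]

theorem abs_det_graphMatrix_fin_le_one {k : ℕ} (s t : Fin k → V) (ρ : Fin k → V)
    (hρ : Function.Injective ρ) : |(graphMatrix ℤ s t ρ).det| ≤ 1 := by
  induction k with
  | zero => simp
  | succ k ih =>
    by_cases hall : ∀ j, ∑ i, graphMatrix ℤ s t ρ i j = 0
    · have : (graphMatrix ℤ s t ρ).det = 0 := by
        refine Matrix.exists_vecMul_eq_zero_iff.1 ⟨fun _ => 1, ?_, ?_⟩
        · exact fun h => one_ne_zero (congrFun h 0)
        · ext j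
          simpa [Matrix.vecMul, dotProduct] using hall j
      simp [this]
    · push Not at hall
      obtain ⟨j, hj⟩ := hall
      have hex : ∃ i0, (∀ i, i ≠ i0 → graphMatrix ℤ s t ρ i j = 0) ∧
          |graphMatrix ℤ s t ρ i0 j| ≤ 1 := by
        have hsum : ∀ x : V, (∃ i0, x = ρ i0 ∧ ∑ i, (if x = ρ i then (1 : ℤ) else 0) = 1) ∨
            ∀ i, x ≠ ρ i := by
          intro x
          by_cases hx : ∃ i0, x = ρ i0
          · obtain ⟨i0, rfl⟩ := hx
            exact Or.inl ⟨i0, rfl, by simp [hρ.eq_iff]⟩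
          · push Not at hx
            exact Or.inr hx
        simp only [graphMatrix, Matrix.of_apply, Finset.sum_sub_distrib] at hj ⊢
        rcases hsum (t j) with ⟨i1, h1, h1'⟩ | h1 <;> rcases hsum (s j) with ⟨i2, h2, h2'⟩ | h2
        · rw [h1', h2'] at hj
          exact absurd rfl hj
        · exact ⟨i1, fun i hi => by simp [h1, hρ.eq_iff, hi.symm, h2], by simp [h1, h2]⟩
        · exact ⟨i2, fun i hi => by simp [h2, hρ.eq_iff, hi.symm, h1], by simp [h1, h2]⟩
        · exact ⟨0, fun i hi => by simp [h1, h2], by simp [h1, h2]⟩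
      obtain ⟨i0, h0, h1⟩ := hex
      rw [Matrix.det_succ_column _ j, Finset.sum_eq_single i0 (fun i _ hi => by simp [h0 i hi])
        (by simp)]
      have h2 := ih (s ∘ j.succAbove) (t ∘ j.succAbove) (ρ ∘ i0.succAbove)
        (hρ.comp Fin.succAbove_right_injective)
      have h3 : (graphMatrix ℤ s t ρ).submatrix i0.succAbove j.succAbove =
          graphMatrix ℤ (s ∘ j.succAbove) (t ∘ j.succAbove) (ρ ∘ i0.succAbove) := rfl
      rw [h3, abs_mul, abs_mul, abs_pow, abs_neg, abs_one, one_pow, one_mul]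
      exact mul_le_one₀ h1 (abs_nonneg _) h2

/-- Square submatrices of an incidence matrix have determinant `0` or `±1`. -/
theorem abs_det_graphMatrix_le_one [Fintype W] [DecidableEq W] (s t : E → V) {ρ : W → V}
    (hρ : Function.Injective ρ) (p : W → E) :
    |((graphMatrix ℤ s t ρ).submatrix id p).det| ≤ 1 := by
  let e := (Fintype.equivFin W).symm
  rw [← Matrix.det_submatrix_equiv_self e]
  exact abs_det_graphMatrix_fin_le_one (s ∘ p ∘ e) (t ∘ p ∘ e) (ρ ∘ e) (hρ.comp e.injective)

theorem graphMatrix_map (s t : E → V) (ρ : W → V) :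
    (graphMatrix ℤ s t ρ).map (Int.cast : ℤ → ℝ) = graphMatrix ℝ s t ρ := by
  ext w i
  simp [graphMatrix]

theorem det_graphMatrix_cast [Fintype W] [DecidableEq W] (s t : E → V) (ρ : W → V) (p : W → E) :
    (((graphMatrix ℤ s t ρ).submatrix id p).det : ℝ) =
      ((graphMatrix ℝ s t ρ).submatrix id p).det := by
  rw [← graphMatrix_map, Int.cast_det, Matrix.submatrix_map]

theorem sum_mul_graphMatrix {R : Type*} [Ring R] (s t : E → V) (U : Finset V) (f : V → R)
    (i : E) (ht : t i ∉ U → f (t i) = 0) (hs : s i ∉ U → f (s i) = 0) :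
    ∑ v : U, f v * graphMatrix R s t (Subtype.val : U → V) v i = f (t i) - f (s i) := by
  simp only [graphMatrix, Matrix.of_apply, mul_sub, mul_ite, mul_one, mul_zero,
    Finset.sum_sub_distrib]
  rw [Finset.sum_coe_sort U fun v => if t i = v then f v else 0,
    Finset.sum_coe_sort U fun v => if s i = v then f v else 0, Finset.sum_ite_eq,
    Finset.sum_ite_eq]
  congr 1
  · split_ifs with h
    · rfl
    · exact (ht h).symm
  · split_ifs with h
    · rfl
    · exact (hs h).symm

end Incidence

section CauchyBinet

variable {W E : Type*} [Fintype W] [DecidableEq W] [Fintype E] [DecidableEq E]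

omit [DecidableEq E] in
theorem det_mul_transpose_eq_sum (B : Matrix W E ℤ) :
    (B * B.transpose).det =
      ∑ p : W → E, (∏ w, B w (p w)) * (B.submatrix id p).det := by
  have h1 : B * B.transpose = fun w => ∑ e, B w e • B.transpose e := by
    ext w v
    simp [Matrix.mul_apply]
  have h2 := (Matrix.detRowAlternating (n := W) (R := ℤ)).toMultilinearMap.map_sum
    (fun w e => B w e • B.transpose e)
  have h3 : (B * B.transpose).det = ∑ p : W → E,
      Matrix.detRowAlternating (fun w => B w (p w) • B.transpose (p w)) := by
    rw [h1]
    exact h2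
  rw [h3]
  refine Finset.sum_congr rfl fun p _ => ?_
  rw [← Matrix.det_transpose (B.submatrix id p)]
  exact (Matrix.detRowAlternating (n := W) (R := ℤ)).toMultilinearMap.map_smul_univ
    (fun w => B w (p w)) (fun w => B.transpose (p w))

theorem sum_fiber_eq_sq (B : Matrix W E ℤ) {p₀ : W → E} (hp₀ : Function.Injective p₀) :
    ∑ p : W → E with Finset.univ.image p = Finset.univ.image p₀,
      (∏ w, B w (p w)) * (B.submatrix id p).det = (B.submatrix id p₀).det ^ 2 := by
  have hσ : ∀ σ : Equiv.Perm W, (B.submatrix id (p₀ ∘ σ)).det =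
      (Equiv.Perm.sign σ : ℤ) * (B.submatrix id p₀).det := fun σ =>
    Matrix.det_permute' σ (B.submatrix id p₀)
  have h1 : ∑ σ : Equiv.Perm W, (∏ w, B w (p₀ (σ w))) * (B.submatrix id (p₀ ∘ σ)).det =
      ∑ p : W → E with Finset.univ.image p = Finset.univ.image p₀,
        (∏ w, B w (p w)) * (B.submatrix id p).det := by
    refine Finset.sum_bij (fun σ _ => p₀ ∘ σ) (fun σ _ => ?_) (fun σ _ σ' _ h => ?_)
      (fun p hp => ?_) (fun _ _ => rfl)
    · simp only [Finset.mem_filter, Finset.mem_univ, true_and]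
      ext e
      simp only [Finset.mem_image, Finset.mem_univ, true_and, Function.comp]
      exact ⟨fun ⟨w, hw⟩ => ⟨σ w, hw⟩, fun ⟨w, hw⟩ => ⟨σ.symm w, by simpa using hw⟩⟩
    · ext w
      exact hp₀ (congrFun h w)
    · simp only [Finset.mem_filter, Finset.mem_univ, true_and] at hp
      have hpinj : Function.Injective p := by
        have h2 := Finset.card_image_of_injective Finset.univ hp₀
        rw [← hp] at h2
        have h3 := Finset.card_image_iff.1 h2
        rwa [Finset.coe_univ, Set.injOn_univ] at h3
      have hex : ∀ w, ∃ v, p₀ v = p w := fun w => by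
        have : p w ∈ Finset.univ.image p₀ := hp ▸ Finset.mem_image_of_mem p (Finset.mem_univ w)
        simpa using this
      choose σ hσ using hex
      have hσi : Function.Injective σ := fun w v h => hpinj (by rw [← hσ, ← hσ, h])
      exact ⟨Equiv.ofBijective σ (Finite.injective_iff_bijective.1 hσi), Finset.mem_univ _,
        funext hσ⟩
  rw [← h1]
  simp only [hσ]
  rw [sq, ← Matrix.det_transpose (B.submatrix id p₀)]
  nth_rewrite 2 [Matrix.det_apply']
  rw [Finset.sum_mul, Matrix.det_transpose]
  refine Finset.sum_congr rfl fun σ _ => ?_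
  simp only [Matrix.transpose_apply, Matrix.submatrix_apply, id, Int.cast_id]
  ring

/-- A consequence of the Cauchy–Binet formula for matrices whose maximal minors are `0`, `±1`. -/
theorem det_mul_transpose_le_card (B : Matrix W E ℤ)
    (hB : ∀ p : W → E, |(B.submatrix id p).det| ≤ 1) (𝓢 : Finset (Finset E))
    (h𝓢 : ∀ p : W → E, Function.Injective p → (B.submatrix id p).det ≠ 0 →
      Finset.univ.image p ∈ 𝓢) :
    (B * B.transpose).det ≤ 𝓢.card := by
  rw [det_mul_transpose_eq_sum, ← Finset.sum_fiberwise Finset.univ (fun p => Finset.univ.image p),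
    Finset.cast_card, ← Finset.sum_subset (Finset.subset_univ 𝓢)]
  · refine Finset.sum_le_sum fun S _ => ?_
    by_cases hS : ∃ p₀ : W → E, Function.Injective p₀ ∧ Finset.univ.image p₀ = S
    · obtain ⟨p₀, hp₀, rfl⟩ := hS
      rw [sum_fiber_eq_sq B hp₀]
      exact (sq_le_one_iff_abs_le_one _).2 (hB p₀)
    · rw [Finset.sum_eq_zero]
      · exact zero_le_one
      · intro p hp
        have hp' : ¬ Function.Injective p := fun h => hS ⟨p, h, (Finset.mem_filter.1 hp).2⟩
        obtain ⟨w, v, hwv, hne⟩ := Function.not_injective_iff.1 hp'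
        rw [Matrix.det_zero_of_column_eq hne (by simp [hwv]), mul_zero]
  · intro S _ hS
    refine Finset.sum_eq_zero fun p hp => ?_
    have hpS := (Finset.mem_filter.1 hp).2
    by_cases hinj : Function.Injective p
    · have : (B.submatrix id p).det = 0 := by
        by_contra hne
        exact hS (hpS ▸ h𝓢 p hinj hne)
      rw [this, mul_zero]
    · obtain ⟨w, v, hwv, hne⟩ := Function.not_injective_iff.1 hinj
      rw [Matrix.det_zero_of_column_eq hne (by simp [hwv]), mul_zero]

end CauchyBinet

section Network

variable {E V F : Type*} [Fintype E] [DecidableEq V]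
  {s t : E → V} {l r : E → F}

/-- The vertices of a graph other than the root `v₀`. -/
def nonrootVertices (s t : E → V) (v₀ : V) : Finset V :=
  (Finset.univ.image s ∪ Finset.univ.image t).erase v₀

theorem source_mem_nonrootVertices {v₀ : V} {i : E} (h : s i ≠ v₀) :
    s i ∈ nonrootVertices s t v₀ := by
  simp [nonrootVertices, h]

theorem target_mem_nonrootVertices {v₀ : V} {i : E} (h : t i ≠ v₀) :
    t i ∈ nonrootVertices s t v₀ := by
  simp [nonrootVertices, h]

theorem sum_potential_mul_graphMatrix {R : Type*} [Ring R] {v₀ : V} (f : V → R) (hf : f v₀ = 0)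
    (i : E) :
    ∑ v : nonrootVertices s t v₀, f v * graphMatrix R s t Subtype.val v i = f (t i) - f (s i) := by
  refine sum_mul_graphMatrix s t _ f i (fun h => ?_) fun h => ?_
  · by_cases hv : t i = v₀
    · rw [hv, hf]
    · exact absurd (target_mem_nonrootVertices hv) h
  · by_cases hv : s i = v₀
    · rw [hv, hf]
    · exact absurd (source_mem_nonrootVertices hv) h

variable [DecidableEq E]

theorem isGraphBase_of_det_ne_zero (h : GraphDual Finset.univ s t l r) {v₀ : V}
    (p : nonrootVertices s t v₀ → E)
    (hp : ((graphMatrix ℤ s t (Subtype.val : nonrootVertices s t v₀ → V)).submatrix id p).det ≠ 0) :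
    IsGraphBase Finset.univ s t l r (Finset.univ.image p) := by
  have hdet : ((graphMatrix ℝ s t
      (Subtype.val : nonrootVertices s t v₀ → V)).submatrix id p).det ≠ 0 := by
    rw [← det_graphMatrix_cast]
    exact_mod_cast hp
  refine ⟨Finset.subset_univ _, fun f hf i _ => ?_, fun g hg i _ => ?_⟩
  · have h1 : (fun v : nonrootVertices s t v₀ => f v - f v₀) = 0 := by
      refine Matrix.eq_zero_of_vecMul_eq_zero hdet ?_
      ext w
      have := sum_potential_mul_graphMatrix (s := s) (t := t) (v₀ := v₀)
        (fun v => f v - f v₀) (sub_self _) (p w)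
      rw [hf (p w) (Finset.mem_image_of_mem p (Finset.mem_univ w)), sub_self] at this
      exact this
    have h2 : ∀ v, v ∈ nonrootVertices s t v₀ → f v = f v₀ := fun v hv =>
      sub_eq_zero.1 (congrFun h1 ⟨v, hv⟩)
    have h3 : f (t i) = f v₀ := by
      by_cases hv : t i = v₀
      · rw [hv]
      · exact h2 _ (target_mem_nonrootVertices hv)
    have h4 : f (s i) = f v₀ := by
      by_cases hv : s i = v₀
      · rw [hv]
      · exact h2 _ (source_mem_nonrootVertices hv)
    rw [h3, h4]
  · have hpinj : Function.Injective p := by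
      intro w v hwv
      by_contra hne
      exact hp (Matrix.det_zero_of_column_eq hne (by simp [hwv]))
    have h1 : (fun w => g (r (p w)) - g (l (p w))) = 0 := by
      refine Matrix.eq_zero_of_mulVec_eq_zero hdet ?_
      ext v
      have := h.orth (fun x => if x = v then 1 else 0) g
      rw [← Finset.sum_subset (Finset.subset_univ (Finset.univ.image p)) (fun j hj hjS => by
        rw [hg j hj hjS, sub_self, mul_zero]), Finset.sum_image fun _ _ _ _ h => hpinj h] at this
      exact this
    by_cases hi : i ∈ Finset.univ.image p
    · obtain ⟨w, _, rfl⟩ := Finset.mem_image.1 hi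
      exact sub_eq_zero.1 (congrFun h1 w)
    · exact hg i (Finset.mem_univ i) hi

omit [DecidableEq E] in
theorem det_graphLaplacian_ne_zero {v₀ : V}
    (hconn : ∀ f : V → ℝ, (∀ i, f (t i) = f (s i)) → ∀ i, f (s i) = f v₀) :
    (graphMatrix ℤ s t (Subtype.val : nonrootVertices s t v₀ → V) *
      (graphMatrix ℤ s t (Subtype.val : nonrootVertices s t v₀ → V)).transpose).det ≠ 0 := by
  intro hdet
  obtain ⟨f, hf0, hf⟩ := Matrix.exists_vecMul_eq_zero_iff.2 hdet
  refine hf0 ?_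
  set B := graphMatrix ℤ s t (Subtype.val : nonrootVertices s t v₀ → V) with hB
  have h1 : Matrix.vecMul f B = 0 := by
    refine dotProduct_self_eq_zero.1 ?_
    rw [← Matrix.vecMul_vecMul, Matrix.vecMul_transpose] at hf
    rw [← Matrix.dotProduct_mulVec, dotProduct_comm, hf, zero_dotProduct]
  let f' : V → ℤ := fun v => if hv : v ∈ nonrootVertices s t v₀ then f ⟨v, hv⟩ else 0
  have hf'v : f' v₀ = 0 := by simp [f', nonrootVertices]
  have hf' : ∀ v : nonrootVertices s t v₀, f' v = f v := fun v => by simp [f']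
  have h2 : ∀ i, f' (t i) = f' (s i) := by
    intro i
    have h3 := sum_potential_mul_graphMatrix (s := s) (t := t) f' hf'v i
    simp only [hf'] at h3
    have h4 := congrFun h1 i
    simp only [Matrix.vecMul, dotProduct] at h4
    rw [h4] at h3
    exact (sub_eq_zero.1 h3.symm)
  have h3 : ∀ i, f' (s i) = 0 := fun i => by
    have := hconn (fun v => (f' v : ℝ)) (fun i => by rw [h2 i]) i
    rw [hf'v] at this
    exact_mod_cast this
  ext v
  rw [← hf' v]
  have hv := v.2
  simp only [nonrootVertices, Finset.mem_erase, Finset.mem_union, Finset.mem_image,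
    Finset.mem_univ, true_and] at hv
  rcases hv.2 with ⟨i, hi⟩ | ⟨i, hi⟩
  · rw [← hi, h3 i]; rfl
  · rw [← hi, h2 i, h3 i]; rfl

/-- The total current through an electrical network with unit resistances and coprime integer
currents is bounded by `τ ^ n`, if the network with `n` edges has a dual graph. -/
theorem current_le_pow {τ : ℝ} (hτ1 : 1 < τ) (hτ : τ ^ 3 = τ ^ 2 + 3)
    (h : GraphDual Finset.univ s t l r) (v₀ v₁ : V)
    (hconn : ∀ f : V → ℝ, (∀ i, f (t i) = f (s i)) → ∀ i, f (s i) = f v₀)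
    (a : E → ℕ) (y : V → ℤ) (hy₀ : y v₀ = 0) (hy : ∀ i, y (t i) - y (s i) = a i) (M : ℕ)
    (hflow : ∀ f : V → ℝ, ∑ i, (f (t i) - f (s i)) * a i = M * (f v₁ - f v₀))
    (hgcd : Finset.univ.gcd a = 1) :
    (M : ℝ) ≤ τ ^ Fintype.card E := by
  set B := graphMatrix ℤ s t (Subtype.val : nonrootVertices s t v₀ → V) with hB
  have hne : (B * B.transpose).det ≠ 0 := det_graphLaplacian_ne_zero hconn
  have hle : (B * B.transpose).det ≤ (graphBases Finset.univ s t l r).card :=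
    det_mul_transpose_le_card B (fun p => abs_det_graphMatrix_le_one s t Subtype.val_injective p)
      _ fun p _ hp => mem_graphBases.2 (isGraphBase_of_det_ne_zero h p hp)
  have hbound := h.card_graphBases_le hτ1 hτ
  have hyB : Matrix.mulVec B.transpose (fun v => y v) = fun i => (a i : ℤ) := by
    ext i
    rw [Matrix.mulVec_transpose, ← hy i]
    exact sum_potential_mul_graphMatrix (s := s) (t := t) y hy₀ i
  have hBa : ∀ v, (M : ℤ) ∣ Matrix.mulVec B (fun i => (a i : ℤ)) v := by
    intro v
    refine ⟨if v₁ = v then 1 else 0, ?_⟩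
    have h1 := hflow fun x => if x = v then 1 else 0
    have h2 : v₀ ≠ v := fun h' => (Finset.mem_erase.1 v.2).1 h'.symm
    simp only [h2, if_false, sub_zero] at h1
    have h3 : ((Matrix.mulVec B (fun i => (a i : ℤ)) v : ℤ) : ℝ) =
        ((M * (if v₁ = v then 1 else 0) : ℤ) : ℝ) := by
      push_cast
      rw [← h1]
      simp [Matrix.mulVec, dotProduct, hB, graphMatrix]
    exact_mod_cast h3
  have hMy : ∀ v : nonrootVertices s t v₀, (M : ℤ) ∣ (B * B.transpose).det * y v := by
    intro v
    have h1 : Matrix.mulVec (B * B.transpose).adjugate (Matrix.mulVec B fun i => (a i : ℤ)) =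
        (B * B.transpose).det • fun v : nonrootVertices s t v₀ => y v := by
      rw [← hyB, Matrix.mulVec_mulVec, Matrix.mulVec_mulVec, Matrix.mul_assoc,
        Matrix.adjugate_mul, Matrix.smul_mulVec, Matrix.one_mulVec]
    have h2 := congrFun h1 v
    simp only [Pi.smul_apply, smul_eq_mul] at h2
    rw [← h2]
    exact Finset.dvd_sum fun w _ => Dvd.dvd.mul_left (hBa w) _
  have hMy' : ∀ v, (∃ i, v = s i ∨ v = t i) → (M : ℤ) ∣ (B * B.transpose).det * y v := by
    intro v ⟨i, hi⟩
    by_cases hv : v = v₀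
    · simp [hv, hy₀]
    · refine hMy ⟨v, ?_⟩
      rcases hi with rfl | rfl
      · exact source_mem_nonrootVertices hv
      · exact target_mem_nonrootVertices hv
  have hMa : ∀ i, (M : ℤ) ∣ (B * B.transpose).det * a i := by
    intro i
    rw [← hy i, mul_sub]
    exact dvd_sub (hMy' _ ⟨i, Or.inr rfl⟩) (hMy' _ ⟨i, Or.inl rfl⟩)
  have hdvd : (M : ℤ) ∣ (B * B.transpose).det := by
    rw [← Int.natAbs_dvd_natAbs, Int.natAbs_natCast]
    have h1 : M ∣ Finset.univ.gcd fun i => (B * B.transpose).det.natAbs * a i := by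
      refine Finset.dvd_gcd fun i _ => ?_
      have := Int.natAbs_dvd_natAbs.2 (hMa i)
      rwa [Int.natAbs_mul, Int.natAbs_natCast, Int.natAbs_natCast] at this
    rwa [Finset.gcd_mul_left, hgcd, mul_one, normalize_eq] at h1
  have hpos : 0 ≤ (B * B.transpose).det := by
    have h1 := (Matrix.posSemidef_self_mul_conjTranspose
      (graphMatrix ℝ s t (Subtype.val : nonrootVertices s t v₀ → V))).det_nonneg
    have h2 : (B * B.transpose).map (Int.cast : ℤ → ℝ) =
        B.map Int.cast * B.transpose.map Int.cast := Matrix.map_mul (f := Int.castRingHom ℝ)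
    rw [← graphMatrix_map, Matrix.conjTranspose_eq_transpose_of_trivial,
      ← Matrix.transpose_map] at h1
    have h3 : 0 ≤ ((B * B.transpose).map (Int.cast : ℤ → ℝ)).det := by
      rw [h2]
      exact h1
    rw [← Int.cast_det] at h3
    exact_mod_cast h3
  have h1 := Int.le_of_dvd (lt_of_le_of_ne hpos hne.symm) hdvd
  have h2 : (M : ℤ) ≤ (graphBases Finset.univ s t l r).card := h1.trans hle
  exact le_trans (by exact_mod_cast h2) hbound

end Network

section CellTiling

variable {n : ℕ} {M N : ℕ} {X Y : Fin n → ℤ} {a : Fin n → ℕ}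

/-- The unit cell `[p, p + 1] × [q, q + 1]` lies in the square with lower-left corner `(x, y)` and
side length `b`. -/
def CellMem (x y : ℤ) (b : ℕ) (p q : ℤ) : Prop :=
  x ≤ p ∧ p < x + b ∧ y ≤ q ∧ q < y + b

/-- The squares with lower-left corners `(X i, Y i)` and side lengths `a i` tile the rectangle
`[0, M] × [0, N]`. -/
structure IsCellTiling (M N : ℕ) (X Y : Fin n → ℤ) (a : Fin n → ℕ) : Prop where
  pos : ∀ i, 0 < a i
  left_nonneg : ∀ i, 0 ≤ X i
  right_le : ∀ i, X i + a i ≤ M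
  bot_nonneg : ∀ i, 0 ≤ Y i
  top_le : ∀ i, Y i + a i ≤ N
  exists_mem : ∀ p q : ℤ, 0 ≤ p → p < M → 0 ≤ q → q < N → ∃ i, CellMem (X i) (Y i) (a i) p q
  unique : ∀ {p q : ℤ} {i j : Fin n},
    CellMem (X i) (Y i) (a i) p q → CellMem (X j) (Y j) (a j) p q → i = j

/-- The unit segment from `(p, q)` to `(p + 1, q)` lies on a horizontal side of one of the squares.
With the roles of `X` and `Y` exchanged, this describes vertical sides. -/
def IsWall (X Y : Fin n → ℤ) (a : Fin n → ℕ) (p q : ℤ) : Prop :=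
  ∃ i, X i ≤ p ∧ p < X i + a i ∧ (q = Y i ∨ q = Y i + a i)

/-- A function on horizontal unit segments which agrees on adjacent segments of sides of squares,
unless these segments are separated by vertical sides above and below their common vertex. -/
def IsSideFunction (X Y : Fin n → ℤ) (a : Fin n → ℕ) (F : ℤ → ℤ → ℝ) : Prop :=
  ∀ p q, IsWall X Y a (p - 1) q → IsWall X Y a p q →
    ¬(IsWall Y X a (q - 1) p ∧ IsWall Y X a q p) → F (p - 1) q = F p q

open Classical in
/-- The restriction of `F` to the sides of squares, extended by zero. -/
noncomputable def wallPart (X Y : Fin n → ℤ) (a : Fin n → ℕ) (F : ℤ → ℤ → ℝ) (p q : ℤ) : ℝ :=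
  if IsWall X Y a p q then F p q else 0

theorem wallPart_of_isWall {F : ℤ → ℤ → ℝ} {p q : ℤ} (h : IsWall X Y a p q) :
    wallPart X Y a F p q = F p q := if_pos h

theorem wallPart_of_not_isWall {F : ℤ → ℤ → ℝ} {p q : ℤ} (h : ¬IsWall X Y a p q) :
    wallPart X Y a F p q = 0 := if_neg h

theorem IsSideFunction.eq_of_isWall {F : ℤ → ℤ → ℝ} (hF : IsSideFunction X Y a F) {A q : ℤ} {k : ℕ}
    (hw : ∀ p, A ≤ p → p < A + k → IsWall X Y a p q)
    (hnv : ∀ p, A < p → p < A + k → ¬(IsWall Y X a (q - 1) p ∧ IsWall Y X a q p))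
    {p : ℤ} (h1 : A ≤ p) (h2 : p < A + k) : F p q = F A q := by
  obtain ⟨m, rfl⟩ := Int.le.dest h1
  induction m with
  | zero => simp
  | succ m ih =>
    push_cast at h1 h2 ⊢
    rw [← ih (by omega) (by omega)]
    have := hF (A + (m + 1)) q (hw _ (by omega) (by omega)) (hw _ (by omega) (by omega))
      (hnv _ (by omega) (by omega))
    rw [← this]
    congr 1
    ring

theorem sum_Ico_int_sub (f : ℤ → ℝ) (m : ℤ) (k : ℕ) :
    ∑ c ∈ Finset.Ico m (m + k), (f (c + 1) - f c) = f (m + k) - f m := by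
  induction k with
  | zero => simp
  | succ k ih =>
    have : Finset.Ico m (m + (k + 1 : ℕ)) = insert (m + (k : ℤ)) (Finset.Ico m (m + k)) := by
      ext c
      simp only [Finset.mem_Ico, Finset.mem_insert]
      omega
    rw [this, Finset.sum_insert (by simp), ih]
    push_cast
    rw [add_assoc]
    ring

/-- Discrete integration by parts: a sum over vertices equals a sum over cells. -/
theorem finsum_vertex_eq_finsum_cell (P Q : ℤ → ℤ → ℝ)
    (hP : (Function.support fun v : ℤ × ℤ => P v.1 v.2).Finite) :
    ∑ᶠ v : ℤ × ℤ, (P (v.1 - 1) v.2 - P v.1 v.2) * (Q (v.2 - 1) v.1 - Q v.2 v.1) =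
      ∑ᶠ c : ℤ × ℤ, (P c.1 (c.2 + 1) - P c.1 c.2) * (Q c.2 (c.1 + 1) - Q c.2 c.1) := by
  have fin : ∀ (e : ℤ × ℤ ≃ ℤ × ℤ) (u : ℤ × ℤ → ℝ),
      (Function.support fun v => P (e v).1 (e v).2 * u v).Finite := by
    intro e u
    refine (hP.preimage e.injective.injOn).subset fun v hv => ?_
    exact left_ne_zero_of_mul hv
  let e₁ : ℤ × ℤ ≃ ℤ × ℤ := (Equiv.subRight (1 : ℤ)).prodCongr (Equiv.refl ℤ)
  let e₂ : ℤ × ℤ ≃ ℤ × ℤ := (Equiv.refl ℤ).prodCongr (Equiv.addRight (1 : ℤ))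
  have a1 := fin e₁ fun v => Q (v.2 - 1) v.1
  have a2 := fin e₁ fun v => Q v.2 v.1
  have a3 := fin (Equiv.refl _) fun v => Q (v.2 - 1) v.1
  have a4 := fin (Equiv.refl _) fun v => Q v.2 v.1
  have b1 := fin e₂ fun v => Q v.2 (v.1 + 1)
  have b2 := fin e₂ fun v => Q v.2 v.1
  have b3 := fin (Equiv.refl _) fun v => Q v.2 (v.1 + 1)
  simp only [Equiv.refl_apply] at a3 a4 b3
  have hl : ∀ v : ℤ × ℤ, (P (v.1 - 1) v.2 - P v.1 v.2) * (Q (v.2 - 1) v.1 - Q v.2 v.1) =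
      (P (e₁ v).1 (e₁ v).2 * Q (v.2 - 1) v.1 - P (e₁ v).1 (e₁ v).2 * Q v.2 v.1) -
      (P v.1 v.2 * Q (v.2 - 1) v.1 - P v.1 v.2 * Q v.2 v.1) := fun v => by
    change _ = (P (v.1 - 1) v.2 * _ - P (v.1 - 1) v.2 * _) - _
    ring
  have hr : ∀ v : ℤ × ℤ, (P v.1 (v.2 + 1) - P v.1 v.2) * (Q v.2 (v.1 + 1) - Q v.2 v.1) =
      (P (e₂ v).1 (e₂ v).2 * Q v.2 (v.1 + 1) - P (e₂ v).1 (e₂ v).2 * Q v.2 v.1) -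
      (P v.1 v.2 * Q v.2 (v.1 + 1) - P v.1 v.2 * Q v.2 v.1) := fun v => by
    change _ = (P v.1 (v.2 + 1) * _ - P v.1 (v.2 + 1) * _) - _
    ring
  simp only [hl, hr]
  have sub : ∀ {f g : ℤ × ℤ → ℝ}, f.support.Finite → g.support.Finite →
      (Function.support fun v => f v - g v).Finite := fun hf hg =>
    (hf.union hg).subset (Function.support_sub _ _)
  rw [finsum_sub_distrib (sub a1 a2) (sub a3 a4), finsum_sub_distrib a1 a2,
    finsum_sub_distrib a3 a4, finsum_sub_distrib (sub b1 b2) (sub b3 a4),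
    finsum_sub_distrib b1 b2, finsum_sub_distrib b3 a4]
  have c1 : ∑ᶠ v, P (e₁ v).1 (e₁ v).2 * Q (v.2 - 1) v.1 =
      ∑ᶠ v, P (e₂ v).1 (e₂ v).2 * Q v.2 (v.1 + 1) := by
    rw [← finsum_comp_equiv (e₁.symm.trans e₂)]
    refine finsum_congr fun v => ?_
    simp [e₁, e₂]
  have c2 : ∑ᶠ v, P (e₁ v).1 (e₁ v).2 * Q v.2 v.1 = ∑ᶠ v : ℤ × ℤ, P v.1 v.2 * Q v.2 (v.1 + 1) := by
    rw [← finsum_comp_equiv e₁.symm]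
    refine finsum_congr fun v => ?_
    simp [e₁]
  have c3 : ∑ᶠ v, P (e₂ v).1 (e₂ v).2 * Q v.2 v.1 = ∑ᶠ v : ℤ × ℤ, P v.1 v.2 * Q (v.2 - 1) v.1 := by
    rw [← finsum_comp_equiv e₂.symm]
    refine finsum_congr fun v => ?_
    simp [e₂, sub_eq_add_neg]
  rw [c1, c2, c3]
  ring

namespace IsCellTiling

theorem swap (h : IsCellTiling M N X Y a) : IsCellTiling N M Y X a where
  pos := h.pos
  left_nonneg := h.bot_nonneg
  right_le := h.top_le
  bot_nonneg := h.left_nonneg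
  top_le := h.right_le
  exists_mem p q h1 h2 h3 h4 := by
    obtain ⟨i, hi⟩ := h.exists_mem q p h3 h4 h1 h2
    exact ⟨i, hi.2.2.1, hi.2.2.2, hi.1, hi.2.1⟩
  unique hi hj := h.unique ⟨hi.2.2.1, hi.2.2.2, hi.1, hi.2.1⟩ ⟨hj.2.2.1, hj.2.2.2, hj.1, hj.2.1⟩

variable (h : IsCellTiling M N X Y a)
include h

theorem isWall_bounds {p q : ℤ} (hw : IsWall X Y a p q) : 0 ≤ p ∧ p < M ∧ 0 ≤ q ∧ q ≤ N := by
  obtain ⟨i, h1, h2, h3⟩ := hw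
  have := h.left_nonneg i
  have := h.right_le i
  have := h.bot_nonneg i
  have := h.top_le i
  omega

theorem not_isWall_of_mem {i : Fin n} {p q : ℤ} (h1 : X i ≤ p) (h2 : p < X i + a i)
    (h3 : Y i < q) (h4 : q < Y i + a i) : ¬IsWall X Y a p q := by
  rintro ⟨j, h5, h6, rfl | rfl⟩
  · have := h.pos j
    have := h.unique (p := p) (q := Y j) (i := i) (j := j)
      ⟨h1, h2, h3.le, h4⟩ ⟨h5, h6, le_rfl, by omega⟩
    subst this
    omega
  · have := h.pos j
    have := h.unique (p := p) (q := Y j + a j - 1) (i := i) (j := j)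
      ⟨h1, h2, by omega, by omega⟩ ⟨h5, h6, by omega, by omega⟩
    subst this
    omega

theorem isWall_bot {p : ℤ} (hN : 0 < N) (h1 : 0 ≤ p) (h2 : p < M) : IsWall X Y a p 0 := by
  obtain ⟨i, hi⟩ := h.exists_mem p 0 h1 h2 le_rfl (by omega)
  have := h.bot_nonneg i
  unfold CellMem at hi
  exact ⟨i, hi.1, hi.2.1, by omega⟩

theorem isWall_top {p : ℤ} (hN : 0 < N) (h1 : 0 ≤ p) (h2 : p < M) : IsWall X Y a p N := by
  obtain ⟨i, hi⟩ := h.exists_mem p (N - 1) h1 h2 (by omega) (by omega)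
  have := h.top_le i
  unfold CellMem at hi
  exact ⟨i, hi.1, hi.2.1, by omega⟩

/-- A horizontal side that ends in the interior of the rectangle or on its vertical sides ends
on a vertical side. -/
theorem isWall_of_isWall_iff_not {p q : ℤ} (hpq : ¬((p = 0 ∨ p = M) ∧ (q = 0 ∨ q = N)))
    (hw : IsWall X Y a (p - 1) q ↔ ¬IsWall X Y a p q) :
    IsWall Y X a (q - 1) p ∧ IsWall Y X a q p := by
  have hb : (0 ≤ p - 1 ∧ p - 1 < M ∧ 0 ≤ q ∧ q ≤ N) ∨ (0 ≤ p ∧ p < M ∧ 0 ≤ q ∧ q ≤ N) := by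
    by_cases h1 : IsWall X Y a p q
    · exact Or.inr (h.isWall_bounds h1)
    · exact Or.inl (h.isWall_bounds (hw.2 h1))
  have hM : 0 < M := by omega
  by_cases hp0 : p = 0
  · subst hp0
    exact ⟨h.swap.isWall_bot hM (by omega) (by omega), h.swap.isWall_bot hM (by omega) (by omega)⟩
  by_cases hpM : p = M
  · subst hpM
    exact ⟨h.swap.isWall_top hM (by omega) (by omega), h.swap.isWall_top hM (by omega) (by omega)⟩
  have hp1 : 0 < p := by omega
  have hp2 : p < M := by omega
  have hq0 : q ≠ 0 := by
    rintro rfl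
    by_cases hN : 0 < N
    · exact hw.1 (h.isWall_bot hN (by omega) (by omega)) (h.isWall_bot hN (by omega) (by omega))
    · by_cases h1 : IsWall X Y a p 0
      · obtain ⟨i, -⟩ := h1
        have := h.bot_nonneg i
        have := h.top_le i
        have := h.pos i
        omega
      · obtain ⟨i, -⟩ := hw.2 h1
        have := h.bot_nonneg i
        have := h.top_le i
        have := h.pos i
        omega
  have hqN : q ≠ N := by
    rintro rfl
    exact hw.1 (h.isWall_top (by omega) (by omega) (by omega))
      (h.isWall_top (by omega) (by omega) (by omega))
  by_cases h1 : IsWall X Y a p q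
  · have h2 : ¬IsWall X Y a (p - 1) q := fun h2 => hw.1 h2 h1
    obtain ⟨j, hj⟩ := h.exists_mem (p - 1) q (by omega) (by omega) (by omega) (by omega)
    unfold CellMem at hj
    have hYj : Y j ≠ q := fun h' => h2 ⟨j, hj.1, hj.2.1, Or.inl h'.symm⟩
    have hXj : X j + a j = p := by
      by_contra h'
      exact h.not_isWall_of_mem (i := j) (by omega) (by omega) (by omega) (by omega) h1
    exact ⟨⟨j, by omega, by omega, by omega⟩, ⟨j, by omega, by omega, by omega⟩⟩
  · obtain ⟨j, hj⟩ := h.exists_mem p q (by omega) (by omega) (by omega) (by omega)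
    unfold CellMem at hj
    have hYj : Y j ≠ q := fun h' => h1 ⟨j, hj.1, hj.2.1, Or.inl h'.symm⟩
    have hXj : X j = p := by
      by_contra h'
      exact h.not_isWall_of_mem (i := j) (by omega) (by omega) (by omega) (by omega) (hw.2 h1)
    exact ⟨⟨j, by omega, by omega, by omega⟩, ⟨j, by omega, by omega, by omega⟩⟩

variable {F G : ℤ → ℤ → ℝ}

theorem eq_bot (hF : IsSideFunction X Y a F) {p : ℤ} (hN : 0 < N) (h1 : 0 ≤ p) (h2 : p < M) :
    F p 0 = F 0 0 := by
  refine hF.eq_of_isWall (A := 0) (k := M) (fun p h3 h4 => h.isWall_bot hN h3 (by omega))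
    (fun p _ _ h5 => ?_) h1 (by omega)
  have := h.swap.isWall_bounds h5.1
  omega

theorem eq_top (hF : IsSideFunction X Y a F) {p : ℤ} (hN : 0 < N) (h1 : 0 ≤ p) (h2 : p < M) :
    F p N = F 0 N := by
  refine hF.eq_of_isWall (A := 0) (k := M) (fun p h3 h4 => h.isWall_top hN h3 (by omega))
    (fun p _ _ h5 => ?_) h1 (by omega)
  have := h.swap.isWall_bounds h5.2
  omega

theorem eq_tile_bot (hF : IsSideFunction X Y a F) {i : Fin n} {p : ℤ} (h1 : X i ≤ p)
    (h2 : p < X i + a i) : F p (Y i) = F (X i) (Y i) := by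
  have hi := h.pos i
  exact hF.eq_of_isWall (fun p h3 h4 => ⟨i, h3, h4, Or.inl rfl⟩)
    (fun p h3 h4 h5 => h.swap.not_isWall_of_mem (i := i) le_rfl (by omega) h3 h4 h5.2) h1 h2

theorem eq_tile_top (hF : IsSideFunction X Y a F) {i : Fin n} {p : ℤ} (h1 : X i ≤ p)
    (h2 : p < X i + a i) : F p (Y i + a i) = F (X i) (Y i + a i) := by
  have hi := h.pos i
  exact hF.eq_of_isWall (fun p h3 h4 => ⟨i, h3, h4, Or.inr rfl⟩)
    (fun p h3 h4 h5 => h.swap.not_isWall_of_mem (i := i) (by omega) (by omega) h3 h4 h5.1) h1 h2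

theorem wallPart_tile (hF : IsSideFunction X Y a F) {i : Fin n} {p q : ℤ} (h1 : X i ≤ p)
    (h2 : p < X i + a i) (h3 : Y i ≤ q) (h4 : q ≤ Y i + a i) :
    wallPart X Y a F p q = wallPart X Y a F (X i) q := by
  have hi := h.pos i
  rcases h3.eq_or_lt with rfl | h3
  · rw [wallPart_of_isWall ⟨i, h1, h2, Or.inl rfl⟩,
      wallPart_of_isWall ⟨i, le_rfl, by omega, Or.inl rfl⟩, h.eq_tile_bot hF h1 h2]
  rcases h4.eq_or_lt with rfl | h4
  · rw [wallPart_of_isWall ⟨i, h1, h2, Or.inr rfl⟩,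
      wallPart_of_isWall ⟨i, le_rfl, by omega, Or.inr rfl⟩, h.eq_tile_top hF h1 h2]
  rw [wallPart_of_not_isWall (h.not_isWall_of_mem h1 h2 h3 h4),
    wallPart_of_not_isWall (h.not_isWall_of_mem (i := i) le_rfl (by omega) h3 h4)]

theorem sum_cells_tile (hF : IsSideFunction X Y a F) (hG : IsSideFunction Y X a G)
    (i : Fin n) :
    ∑ c ∈ Finset.Ico (X i) (X i + a i) ×ˢ Finset.Ico (Y i) (Y i + a i),
      (wallPart X Y a F c.1 (c.2 + 1) - wallPart X Y a F c.1 c.2) *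
        (wallPart Y X a G c.2 (c.1 + 1) - wallPart Y X a G c.2 c.1) =
      (F (X i) (Y i + a i) - F (X i) (Y i)) * (G (Y i) (X i + a i) - G (Y i) (X i)) := by
  have hi := h.pos i
  have h1 : ∀ c ∈ Finset.Ico (X i) (X i + a i) ×ˢ Finset.Ico (Y i) (Y i + a i),
      (wallPart X Y a F c.1 (c.2 + 1) - wallPart X Y a F c.1 c.2) *
        (wallPart Y X a G c.2 (c.1 + 1) - wallPart Y X a G c.2 c.1) =
      (wallPart Y X a G (Y i) (c.1 + 1) - wallPart Y X a G (Y i) c.1) *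
      (wallPart X Y a F (X i) (c.2 + 1) - wallPart X Y a F (X i) c.2) := by
    intro c hc
    simp only [Finset.mem_product, Finset.mem_Ico] at hc
    rw [h.wallPart_tile hF (i := i) (p := c.1) (q := c.2) (by omega) (by omega) (by omega)
        (by omega),
      h.wallPart_tile hF (i := i) (p := c.1) (q := c.2 + 1) (by omega) (by omega) (by omega)
        (by omega),
      h.swap.wallPart_tile hG (i := i) (p := c.2) (q := c.1) (by omega) (by omega) (by omega)
        (by omega),
      h.swap.wallPart_tile hG (i := i) (p := c.2) (q := c.1 + 1) (by omega) (by omega) (by omega)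
        (by omega), mul_comm]
  rw [Finset.sum_congr rfl h1, Finset.sum_product]
  dsimp only
  rw [← Finset.sum_mul_sum,
    sum_Ico_int_sub (wallPart X Y a F (X i)), sum_Ico_int_sub (wallPart Y X a G (Y i)),
    wallPart_of_isWall ⟨i, le_rfl, by omega, Or.inl rfl⟩,
    wallPart_of_isWall ⟨i, le_rfl, by omega, Or.inr rfl⟩,
    wallPart_of_isWall ⟨i, le_rfl, by omega, Or.inl rfl⟩,
    wallPart_of_isWall ⟨i, le_rfl, by omega, Or.inr rfl⟩, mul_comm]

theorem finsum_cells_eq (hF : IsSideFunction X Y a F)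
    (hG : IsSideFunction Y X a G) :
    ∑ᶠ c : ℤ × ℤ, (wallPart X Y a F c.1 (c.2 + 1) - wallPart X Y a F c.1 c.2) *
        (wallPart Y X a G c.2 (c.1 + 1) - wallPart Y X a G c.2 c.1) =
      ∑ i, (F (X i) (Y i + a i) - F (X i) (Y i)) * (G (Y i) (X i + a i) - G (Y i) (X i)) := by
  rw [finsum_eq_sum_of_support_subset (s := Finset.univ.biUnion fun i =>
    Finset.Ico (X i) (X i + a i) ×ˢ Finset.Ico (Y i) (Y i + a i)), Finset.sum_biUnion]
  · exact Finset.sum_congr rfl fun i _ => h.sum_cells_tile hF hG i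
  · intro i _ j _ hij
    refine Finset.disjoint_left.2 fun c hci hcj => hij ?_
    simp only [Finset.mem_product, Finset.mem_Ico] at hci hcj
    exact h.unique (p := c.1) (q := c.2) ⟨hci.1.1, hci.1.2, hci.2⟩ ⟨hcj.1.1, hcj.1.2, hcj.2⟩
  · rintro ⟨p, q⟩ hc
    have hc1 := left_ne_zero_of_mul hc
    have hc2 := right_ne_zero_of_mul hc
    have hp : 0 ≤ p ∧ p < M := by
      by_contra hp
      refine hc1 ?_
      simp only
      rw [wallPart_of_not_isWall, wallPart_of_not_isWall, sub_self]
      all_goals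
        intro hw
        have := h.isWall_bounds hw
        omega
    have hq : 0 ≤ q ∧ q < N := by
      by_contra hq
      refine hc2 ?_
      simp only
      rw [wallPart_of_not_isWall, wallPart_of_not_isWall, sub_self]
      all_goals
        intro hw
        have := h.swap.isWall_bounds hw
        omega
    obtain ⟨i, hi⟩ := h.exists_mem p q hp.1 hp.2 hq.1 hq.2
    simp only [Finset.coe_biUnion, Set.mem_iUnion, Finset.mem_coe, Finset.mem_product,
      Finset.mem_Ico, Finset.mem_univ]
    exact ⟨i, trivial, ⟨hi.1, hi.2.1⟩, hi.2.2⟩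

/-- Green's formula for a squared rectangle. -/
theorem sum_tiles_eq (hM : 0 < M) (hN : 0 < N)
    (hF : ∀ p q, IsWall X Y a (p - 1) q → IsWall X Y a p q → F (p - 1) q = F p q)
    (hG : IsSideFunction Y X a G) :
    ∑ i, (F (X i) (Y i + a i) - F (X i) (Y i)) * (G (Y i) (X i + a i) - G (Y i) (X i)) =
      (F 0 N - F 0 0) * (G 0 M - G 0 0) := by
  have hF' : IsSideFunction X Y a F := fun p q h1 h2 _ => hF p q h1 h2
  rw [← h.finsum_cells_eq hF' hG, ← finsum_vertex_eq_finsum_cell]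
  swap
  · refine Set.Finite.subset (Finset.finite_toSet (Finset.Ico (0 : ℤ) M ×ˢ Finset.Icc (0 : ℤ) N))
      fun v hv => ?_
    by_contra hv'
    refine hv (wallPart_of_not_isWall fun hw => hv' ?_)
    have := h.isWall_bounds hw
    simp only [Finset.mem_coe, Finset.mem_product, Finset.mem_Ico, Finset.mem_Icc]
    omega
  rw [finsum_eq_sum_of_support_subset (s := ({0, (M : ℤ)} : Finset ℤ) ×ˢ ({0, (N : ℤ)} : Finset ℤ))]
  · have hM' : (0 : ℤ) ≠ M := by omega
    have hN' : (0 : ℤ) ≠ N := by omega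
    have hl : ∀ q, ¬IsWall X Y a (0 - 1) q := fun q hw => by
      have := h.isWall_bounds hw
      omega
    have hr : ∀ q, ¬IsWall X Y a M q := fun q hw => by
      have := h.isWall_bounds hw
      omega
    have hb : ∀ p, ¬IsWall Y X a (0 - 1) p := fun p hw => by
      have := h.swap.isWall_bounds hw
      omega
    have ht : ∀ p, ¬IsWall Y X a N p := fun p hw => by
      have := h.swap.isWall_bounds hw
      omega
    rw [Finset.sum_product, Finset.sum_pair hM', Finset.sum_pair hN', Finset.sum_pair hN']
    simp only [wallPart_of_not_isWall (hl _), wallPart_of_not_isWall (hr _),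
      wallPart_of_not_isWall (hb _), wallPart_of_not_isWall (ht _)]
    rw [wallPart_of_isWall (h.isWall_bot hN le_rfl (by omega)),
      wallPart_of_isWall (h.isWall_top hN le_rfl (by omega)),
      wallPart_of_isWall (h.isWall_bot hN (p := M - 1) (by omega) (by omega)),
      wallPart_of_isWall (h.isWall_top hN (p := M - 1) (by omega) (by omega)),
      wallPart_of_isWall (h.swap.isWall_bot hM le_rfl (by omega)),
      wallPart_of_isWall (h.swap.isWall_top hM le_rfl (by omega)),
      wallPart_of_isWall (h.swap.isWall_bot hM (p := N - 1) (by omega) (by omega)),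
      wallPart_of_isWall (h.swap.isWall_top hM (p := N - 1) (by omega) (by omega)),
      h.eq_bot hF' hN (p := M - 1) (by omega) (by omega),
      h.eq_top hF' hN (p := M - 1) (by omega) (by omega),
      h.swap.eq_bot hG hM (p := N - 1) (by omega) (by omega),
      h.swap.eq_top hG hM (p := N - 1) (by omega) (by omega)]
    ring
  · rintro ⟨p, q⟩ hv
    by_contra hpq
    have hpq' : ¬((p = 0 ∨ p = M) ∧ (q = 0 ∨ q = N)) := by simpa using hpq
    refine hv ?_
    simp only
    by_cases h1 : IsWall X Y a (p - 1) q
    · by_cases h2 : IsWall X Y a p q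
      · rw [wallPart_of_isWall h1, wallPart_of_isWall h2, hF p q h1 h2, sub_self, zero_mul]
      · have h3 := h.isWall_of_isWall_iff_not hpq' (by simp [h1, h2])
        rw [wallPart_of_isWall h3.1, wallPart_of_isWall h3.2,
          hG q p h3.1 h3.2 fun h' => h2 h'.2, sub_self, mul_zero]
    · by_cases h2 : IsWall X Y a p q
      · have h3 := h.isWall_of_isWall_iff_not hpq' (by simp [h1, h2])
        rw [wallPart_of_isWall h3.1, wallPart_of_isWall h3.2,
          hG q p h3.1 h3.2 fun h' => h1 h'.1, sub_self, mul_zero]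
      · rw [wallPart_of_not_isWall h1, wallPart_of_not_isWall h2, sub_self, zero_mul]

end IsCellTiling

end CellTiling

section SquaringNetwork

variable {n : ℕ}

/-- Adjacent horizontal unit segments of sides of squares. -/
def SideRel (X Y : Fin n → ℤ) (a : Fin n → ℕ) (u v : ℤ × ℤ) : Prop :=
  ∃ p q, IsWall X Y a (p - 1) q ∧ IsWall X Y a p q ∧ u = (p - 1, q) ∧ v = (p, q)

/-- Adjacent vertical unit segments of sides of squares that are not separated by horizontal sides,
where all segments on the boundary of the rectangle of width `M` are identified. -/
def DualSideRel (M : ℕ) (X Y : Fin n → ℤ) (a : Fin n → ℕ) (u v : ℤ × ℤ) : Prop :=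
  (∃ p q, ¬(IsWall X Y a (p - 1) q ∧ IsWall X Y a p q) ∧ u = (q - 1, p) ∧ v = (q, p)) ∨
    (u.2 = 0 ∧ v.2 = M)

namespace IsCellTiling

variable {M N : ℕ} {X Y : Fin n → ℤ} {a : Fin n → ℕ} (h : IsCellTiling M N X Y a)
include h

theorem graphDual (hM : 0 < M) (hN : 0 < N) :
    GraphDual Finset.univ (fun i => Quot.mk (SideRel X Y a) (X i, Y i))
      (fun i => Quot.mk (SideRel X Y a) (X i, Y i + a i))
      (fun i => Quot.mk (DualSideRel M X Y a) (Y i, X i))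
      (fun i => Quot.mk (DualSideRel M X Y a) (Y i, X i + a i)) where
  orth f g := by
    have := h.sum_tiles_eq hM hN (F := fun p q => f (Quot.mk _ (p, q)))
      (G := fun q p => g (Quot.mk _ (q, p)))
      (fun p q h1 h2 => congrArg f (Quot.sound ⟨p, q, h1, h2, rfl, rfl⟩))
      (fun q p _ _ h1 => congrArg g (Quot.sound (Or.inl ⟨p, q, h1, rfl, rfl⟩)))
    rw [this]
    have h1 : (Quot.mk (DualSideRel M X Y a) (0, 0)) = Quot.mk _ (0, (M : ℤ)) :=
      Quot.sound (Or.inr ⟨rfl, rfl⟩)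
    rw [h1, sub_self, mul_zero]
  complete z hz := by
    classical
    have flow : ∀ F : ℤ → ℤ → ℝ,
        (∀ p q, IsWall X Y a (p - 1) q → IsWall X Y a p q → F (p - 1) q = F p q) →
        ∑ i, z i * (F (X i) (Y i + a i) - F (X i) (Y i)) = 0 := fun F hF =>
      hz (Quot.lift (fun u => F u.1 u.2) (by
        rintro _ _ ⟨p, q, h1, h2, rfl, rfl⟩
        exact hF p q h1 h2))
    let G : ℤ × ℤ → ℝ := fun u =>
      ∑ i, z i * if Y i ≤ u.1 ∧ u.1 < Y i + a i ∧ X i < u.2 then 1 else 0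
    have hG : ∀ u v, DualSideRel M X Y a u v → G u = G v := by
      rintro u v (⟨p, q, h1, rfl, rfl⟩ | ⟨h1, h2⟩)
      · rw [← sub_eq_zero, ← flow fun c d => if d = q ∧ c < p then 1 else 0]
        · simp only [G, ← Finset.sum_sub_distrib, ← mul_sub]
          refine Finset.sum_congr rfl fun i _ => ?_
          have hi := h.pos i
          congr 1
          split_ifs <;> first | omega | norm_num
        · intro c d h2 h3
          by_cases hc : d = q ∧ c = p
          · obtain ⟨rfl, rfl⟩ := hc
            exact absurd ⟨h2, h3⟩ h1
          · congr 1
            exact propext (by omega)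
      · have hu : G u = 0 := Finset.sum_eq_zero fun i _ => by
          have := h.left_nonneg i
          rw [if_neg (by omega), mul_zero]
        have hv : G v = 0 := by
          rw [← flow fun _ d => if v.1 < d then 1 else 0]
          · refine Finset.sum_congr rfl fun i _ => ?_
            have hi := h.pos i
            have := h.right_le i
            congr 1
            split_ifs <;> first | omega | norm_num
          · exact fun _ _ _ _ => rfl
        rw [hu, hv]
    refine ⟨Quot.lift G hG, fun i _ => ?_⟩
    change z i = G (Y i, X i + a i) - G (Y i, X i)
    have hi := h.pos i
    simp only [G, ← Finset.sum_sub_distrib, ← mul_sub]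
    rw [Finset.sum_eq_single i]
    · rw [if_pos (by omega), if_neg (by omega)]
      ring
    · intro j _ hj
      by_cases hc : Y j ≤ Y i ∧ Y i < Y j + a j ∧ X i ≤ X j ∧ X j < X i + a i
      · refine absurd ?_ hj
        have := h.pos j
        exact h.unique (p := X j) (q := Y i) ⟨le_rfl, by omega, hc.1, hc.2.1⟩
          ⟨hc.2.2.1, hc.2.2.2, le_rfl, by omega⟩
      · refine mul_eq_zero_of_right _ ?_
        split_ifs <;> first | omega | norm_num
    · simp

theorem eq_root (hN : 0 < N) {F : ℤ → ℤ → ℝ} (hF : IsSideFunction X Y a F)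
    (hc : ∀ i, F (X i) (Y i + a i) = F (X i) (Y i)) (i : Fin n) : F (X i) (Y i) = F 0 0 := by
  obtain ⟨m, hm⟩ := Int.eq_ofNat_of_zero_le (h.bot_nonneg i)
  induction m using Nat.strong_induction_on generalizing i with
  | _ m ih =>
    have h1 := h.left_nonneg i
    have h2 := h.right_le i
    have h3 := h.pos i
    have h4 := h.top_le i
    rcases Nat.eq_zero_or_pos m with rfl | hpos
    · rw [hm]
      exact h.eq_bot hF hN h1 (by omega)
    · obtain ⟨j, hj⟩ := h.exists_mem (X i) (Y i - 1) h1 (by omega) (by omega) (by omega)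
      unfold CellMem at hj
      have hYj : Y j + a j = Y i := by
        by_contra h'
        have := h.unique (p := X i) (q := Y i) (i := i) (j := j)
          ⟨le_rfl, by omega, le_rfl, by omega⟩ ⟨hj.1, hj.2.1, by omega, by omega⟩
        subst this
        omega
      have h5 := h.pos j
      have h6 := h.bot_nonneg j
      rw [← hYj, h.eq_tile_top hF hj.1 hj.2.1, hc j]
      exact ih (Y j).toNat (by omega) j (by omega)

theorem width_le_pow {τ : ℝ} (hτ1 : 1 < τ) (hτ : τ ^ 3 = τ ^ 2 + 3) (hM : 0 < M) (hN : 0 < N)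
    (hgcd : Finset.univ.gcd a = 1) : (M : ℝ) ≤ τ ^ n := by
  classical
  have := current_le_pow hτ1 hτ (h.graphDual hM hN) (Quot.mk _ (0, 0)) (Quot.mk _ (0, (N : ℤ)))
    (fun f hf i => h.eq_root hN (F := fun p q => f (Quot.mk _ (p, q)))
      (fun p q h1 h2 _ => congrArg f (Quot.sound ⟨p, q, h1, h2, rfl, rfl⟩)) hf i)
    a (Quot.lift Prod.snd (by rintro _ _ ⟨p, q, -, -, rfl, rfl⟩; rfl)) rfl
    (fun i => add_sub_cancel_left (Y i) (a i : ℤ)) M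
    (fun f => by
      have := h.sum_tiles_eq hM hN (F := fun p q => f (Quot.mk _ (p, q)))
        (G := fun _ p => (p : ℝ))
        (fun p q h1 h2 => congrArg f (Quot.sound ⟨p, q, h1, h2, rfl, rfl⟩))
        (fun q p _ _ h1 => rfl)
      rw [mul_comm]
      simpa using this) hgcd
  simpa using this

end IsCellTiling

end SquaringNetwork

section Squaring

variable {n : ℕ} {M N : ℕ} {x y : Fin n → ℝ} {a : Fin n → ℕ}

/-- Coordinate description of a dissection of `[0, M] × [0, N]` into squares with lower-left
corners `(x i, y i)` and integer sides `a i`. -/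
structure IsSquaring (M N : ℕ) (x y : Fin n → ℝ) (a : Fin n → ℕ) : Prop where
  pos : ∀ i, 0 < a i
  left_nonneg : ∀ i, 0 ≤ x i
  right_le : ∀ i, x i + a i ≤ M
  bot_nonneg : ∀ i, 0 ≤ y i
  top_le : ∀ i, y i + a i ≤ N
  covers : ∀ u v : ℝ, 0 ≤ u → u ≤ M → 0 ≤ v → v ≤ N →
    ∃ i, x i ≤ u ∧ u ≤ x i + a i ∧ y i ≤ v ∧ v ≤ y i + a i
  unique : ∀ i j, x i < x j + a j → x j < x i + a i → y i < y j + a j → y j < y i + a i → i = j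

namespace IsSquaring

theorem swap (h : IsSquaring M N x y a) : IsSquaring N M y x a where
  pos := h.pos
  left_nonneg := h.bot_nonneg
  right_le := h.top_le
  bot_nonneg := h.left_nonneg
  top_le := h.right_le
  covers u v h1 h2 h3 h4 := by
    obtain ⟨i, hi⟩ := h.covers v u h3 h4 h1 h2
    exact ⟨i, hi.2.2.1, hi.2.2.2, hi.1, hi.2.1⟩
  unique i j h1 h2 h3 h4 := h.unique i j h3 h4 h1 h2

theorem exists_right_eq (h : IsSquaring M N x y a) {i : Fin n} (hi : 0 < x i) :
    ∃ j, x j + a j = x i := by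
  have hpos : ∀ j, (0 : ℝ) < a j := fun j => by exact_mod_cast h.pos j
  have hev : ∀ᶠ u in nhdsWithin (x i) (Set.Iio (x i)),
      u < x i ∧ 0 < u ∧ ∀ j, x j + a j < x i → x j + a j < u := by
    refine Filter.Eventually.and self_mem_nhdsWithin (Filter.Eventually.and
      (nhdsWithin_le_nhds (eventually_gt_nhds hi)) (Filter.eventually_all.2 fun j => ?_))
    by_cases hj : x j + a j < x i
    · filter_upwards [nhdsWithin_le_nhds (eventually_gt_nhds hj)] with u hu _ using hu
    · exact Filter.Eventually.of_forall fun u h' => absurd h' hj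
  obtain ⟨u, hu, hu0, huj⟩ := hev.exists
  have hai := hpos i
  have h1 := h.right_le i
  have h2 := h.bot_nonneg i
  have h3 := h.top_le i
  obtain ⟨j, hj1, hj2, hj3, hj4⟩ := h.covers u (y i + a i / 2) hu0.le (by linarith) (by linarith)
    (by linarith)
  refine ⟨j, le_antisymm (le_of_not_gt fun hlt => ?_) (le_of_not_gt fun hlt => ?_)⟩
  · have := h.unique i j hlt (by linarith) (by linarith) (by linarith)
    subst this
    linarith
  · exact absurd (huj j hlt) hj2.not_gt

theorem exists_int_left (h : IsSquaring M N x y a) (i : Fin n) : ∃ k : ℤ, x i = k := by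
  by_contra hi
  obtain ⟨i, hi, hmin⟩ := (Set.toFinite {i | ¬∃ k : ℤ, x i = k}).exists_minimalFor x _ ⟨i, hi⟩
  have h0 : 0 < x i := (h.left_nonneg i).lt_of_ne fun h0 => hi ⟨0, by simp [← h0]⟩
  obtain ⟨j, hj⟩ := h.exists_right_eq h0
  have hpos : (0 : ℝ) < a j := by exact_mod_cast h.pos j
  by_cases hk : ∃ k : ℤ, x j = k
  · obtain ⟨k, hk⟩ := hk
    exact hi ⟨k + a j, by push_cast; rw [← hj, hk]⟩
  · have := hmin hk (by linarith)
    linarith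

theorem exists_isCellTiling (h : IsSquaring M N x y a) :
    ∃ X Y : Fin n → ℤ, IsCellTiling M N X Y a := by
  choose X hX using h.exists_int_left
  choose Y hY using h.swap.exists_int_left
  refine ⟨X, Y, h.pos, fun i => ?_, fun i => ?_, fun i => ?_, fun i => ?_, ?_, ?_⟩
  · have := h.left_nonneg i
    rw [hX] at this
    exact_mod_cast this
  · have := h.right_le i
    rw [hX] at this
    exact_mod_cast this
  · have := h.bot_nonneg i
    rw [hY] at this
    exact_mod_cast this
  · have := h.top_le i
    rw [hY] at this
    exact_mod_cast this
  · intro p q hp0 hpM hq0 hqN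
    have hp0' : (0 : ℝ) ≤ p := by exact_mod_cast hp0
    have hq0' : (0 : ℝ) ≤ q := by exact_mod_cast hq0
    have hpM' : (p : ℝ) + 1 ≤ M := by exact_mod_cast hpM
    have hqN' : (q : ℝ) + 1 ≤ N := by exact_mod_cast hqN
    obtain ⟨i, h1, h2, h3, h4⟩ := h.covers (p + 1 / 2) (q + 1 / 2) (by linarith) (by linarith)
      (by linarith) (by linarith)
    rw [hX] at h1 h2
    rw [hY] at h3 h4
    have lower : ∀ {k m : ℤ}, (k : ℝ) ≤ m + 1 / 2 → k ≤ m := fun {k m} hk => by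
      have : (k : ℝ) < ((m + 1 : ℤ) : ℝ) := by
        push_cast
        linarith
      exact Int.lt_add_one_iff.1 (Int.cast_lt.1 this)
    have upper : ∀ {k m : ℤ} {b : ℕ}, (m : ℝ) + 1 / 2 ≤ k + b → m < k + b := fun {k m b} hk => by
      have : (m : ℝ) < ((k + b : ℤ) : ℝ) := by
        push_cast
        linarith
      exact Int.cast_lt.1 this
    exact ⟨i, lower h1, upper h2, lower h3, upper h4⟩
  · rintro p q i j ⟨h1, h2, h3, h4⟩ ⟨h5, h6, h7, h8⟩
    have cast : ∀ {k m : ℤ} {b : ℕ}, k < m + b → (k : ℝ) < m + b := fun h' => by exact_mod_cast h'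
    refine h.unique i j ?_ ?_ ?_ ?_
    all_goals
      simp only [hX, hY]
      exact cast (by omega)

theorem width_le_pow (h : IsSquaring M N x y a) {τ : ℝ} (hτ1 : 1 < τ) (hτ : τ ^ 3 = τ ^ 2 + 3)
    (hM : 0 < M) (hN : 0 < N) (hgcd : Finset.univ.gcd a = 1) : (M : ℝ) ≤ τ ^ n := by
  obtain ⟨X, Y, hXY⟩ := h.exists_isCellTiling
  exact hXY.width_le_pow hτ1 hτ hM hN hgcd

end IsSquaring

theorem interior_sqTile (x y : ℝ) (a : ℕ) :
    interior (sqTile x y a) = Set.Ioo x (x + a) ×ˢ Set.Ioo y (y + a) := by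
  rw [sqTile, interior_prod_eq, interior_Icc, interior_Icc]

theorem mem_sqTile {x y u v : ℝ} {a : ℕ} :
    (u, v) ∈ sqTile x y a ↔ x ≤ u ∧ u ≤ x + a ∧ y ≤ v ∧ v ≤ y + a := by
  simp only [sqTile, Set.mem_prod, Set.mem_Icc, and_assoc]

theorem isSquaring_of_sqTile (ha : ∀ i, 0 < a i)
    (hsub : ∀ i, sqTile (x i) (y i) (a i) ⊆ Set.Icc (0 : ℝ) M ×ˢ Set.Icc (0 : ℝ) N)
    (hdisj : Pairwise fun i j =>
      Disjoint (interior (sqTile (x i) (y i) (a i))) (interior (sqTile (x j) (y j) (a j))))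
    (hcover : (⋃ i, sqTile (x i) (y i) (a i)) = Set.Icc (0 : ℝ) M ×ˢ Set.Icc (0 : ℝ) N) :
    IsSquaring M N x y a := by
  have hbl : ∀ i, (x i, y i) ∈ Set.Icc (0 : ℝ) M ×ˢ Set.Icc (0 : ℝ) N := fun i =>
    hsub i (mem_sqTile.2 ⟨le_rfl, by simp, le_rfl, by simp⟩)
  have htr : ∀ i, (x i + a i, y i + a i) ∈ Set.Icc (0 : ℝ) M ×ˢ Set.Icc (0 : ℝ) N := fun i =>
    hsub i (mem_sqTile.2 ⟨by simp, le_rfl, by simp, le_rfl⟩)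
  refine ⟨ha, fun i => (hbl i).1.1, fun i => (htr i).1.2, fun i => (hbl i).2.1,
    fun i => (htr i).2.2, fun u v h1 h2 h3 h4 => ?_, fun i j h1 h2 h3 h4 => ?_⟩
  · have : (u, v) ∈ ⋃ i, sqTile (x i) (y i) (a i) := by
      rw [hcover]
      exact ⟨⟨h1, h2⟩, h3, h4⟩
    obtain ⟨i, hi⟩ := Set.mem_iUnion.1 this
    exact ⟨i, mem_sqTile.1 hi⟩
  · by_contra hij
    have hpos : ∀ k, (0 : ℝ) < a k := fun k => by exact_mod_cast ha k
    have hd := hdisj hij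
    simp only [interior_sqTile] at hd
    obtain ⟨u, hu1, hu2⟩ := exists_between (a₁ := max (x i) (x j))
      (a₂ := min (x i + a i) (x j + a j)) (by simp [h1, h2, hpos])
    obtain ⟨v, hv1, hv2⟩ := exists_between (a₁ := max (y i) (y j))
      (a₂ := min (y i + a i) (y j + a j)) (by simp [h3, h4, hpos])
    rw [max_lt_iff] at hu1 hv1
    rw [lt_min_iff] at hu2 hv2
    exact Set.disjoint_left.1 hd (show (u, v) ∈ _ from ⟨⟨hu1.1, hu2.1⟩, hv1.1, hv2.1⟩)
      ⟨⟨hu1.2, hu2.2⟩, hv1.2, hv2.2⟩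

end Squaring

/-- **Lower bound for the size of a prime squaring.**
If the rectangle `R = [0,M] × [0,N]` (with `M, N` positive integers) is dissected into
`n` axis-parallel squares with positive integer side lengths `a 1, …, a n` whose gcd
is `1` (a prime squaring), then `τ ^ n ≥ max M N`, where `τ > 1` is the real root of
`x³ = x² + 3`; equivalently, `n ≥ log_τ (max M N)`. -/
theorem prime_squaring_bound (τ : ℝ) (hτ1 : 1 < τ) (hτ : τ ^ 3 = τ ^ 2 + 3)
    (M N : ℕ) (hM : 0 < M) (hN : 0 < N) (n : ℕ)
    (x y : Fin n → ℝ) (a : Fin n → ℕ) (ha : ∀ i, 0 < a i)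
    (hsub : ∀ i, sqTile (x i) (y i) (a i) ⊆
      Set.Icc (0 : ℝ) M ×ˢ Set.Icc (0 : ℝ) N)
    (hdisj : Pairwise fun i j =>
      Disjoint (interior (sqTile (x i) (y i) (a i)))
        (interior (sqTile (x j) (y j) (a j))))
    (hcover : (⋃ i, sqTile (x i) (y i) (a i)) =
      Set.Icc (0 : ℝ) M ×ˢ Set.Icc (0 : ℝ) N)
    (hprime : Finset.univ.gcd a = 1) :
    τ ^ n ≥ (max M N : ℝ) := by
  have h := isSquaring_of_sqTile ha hsub hdisj hcover
  exact max_le (h.width_le_pow hτ1 hτ hM hN hprime) (h.swap.width_le_pow hτ1 hτ hN hM hprime)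
end
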